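/- There exist a bounded open set Ω ⊂ ℝ²₊ satisfying the Steiner symmetry condition with ∫_Ω x₂ dx = 1, a constant W > 0 with W = (4/3)·E(1_Ω), and a radius R > 0, such that Ω = {x ∈ ℝ²₊ : 𝒢[1_Ω](x) − W·x₂ > 0} and {x ∈ ℝ²₊ : |x| < R} ⊆ Ω. (Existence of a Sadovskii vortex patch in steady form: the patch solves the traveling-wave relation with zero flux constant and touches the horizontal axis.) -/

import Mathlib

open MeasureTheory Real Set NNReal Filter Topology

noncomputable section

/-- The upper half plane `ℝ²₊`. -/
def H : Set (ℝ × ℝ) := {p | 0 < p.2}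

/-- The half-plane Green function
`G(x,y) = (1/(4π)) log(1 + 4 x₂ y₂ / |x-y|²)` (Euclidean distance). -/
def G (x y : ℝ × ℝ) : ℝ :=
  (1 / (4 * π)) * Real.log (1 + 4 * x.2 * y.2 / ((x.1 - y.1) ^ 2 + (x.2 - y.2) ^ 2))

/-- The potential `𝒢[ω](x) = ∫_{ℝ²₊} G(x,y) ω(y) dy`. -/
def Gpot (ω : ℝ × ℝ → ℝ) (x : ℝ × ℝ) : ℝ := ∫ y in H, G x y * ω y

/-- The kinetic energy `E(ω) = (1/2) ∫∫ G(x,y) ω(x) ω(y) dy dx`. -/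
def energy (ω : ℝ × ℝ → ℝ) : ℝ :=
  (1 / 2) * ∫ x in H, ∫ y in H, G x y * ω x * ω y

/-- The `L¹(ℝ²₊)` norm (mass). -/
def norm1 (ω : ℝ × ℝ → ℝ) : ℝ := ∫ x in H, |ω x|

/-- The `L²(ℝ²₊)` norm. -/
def norm2 (ω : ℝ × ℝ → ℝ) : ℝ := (∫ x in H, ω x ^ 2) ^ ((1 : ℝ) / 2)

/-- The impulse `‖x₂ ω‖₁ = ∫_{ℝ²₊} x₂ |ω(x)| dx`. -/
def impulse (ω : ℝ × ℝ → ℝ) : ℝ := ∫ x in H, x.2 * |ω x|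

/-- `ω ∈ (L¹ ∩ L²)(ℝ²₊)`. -/
def MemL1L2 (ω : ℝ × ℝ → ℝ) : Prop :=
  Integrable ω (volume.restrict H) ∧ Integrable (fun x => ω x ^ 2) (volume.restrict H)

/-- Finiteness of the impulse `‖x₂ ω‖₁ < ∞`. -/
def ImpulseFinite (ω : ℝ × ℝ → ℝ) : Prop :=
  Integrable (fun x : ℝ × ℝ => x.2 * |ω x|) (volume.restrict H)

/-- The admissible class `K_M`: patches `ω = 1_A` a.e. on `ℝ²₊` with
impulse `∫_A x₂ = M` and mass `|A| ≤ 1`. -/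
def memK (M : ℝ) (ω : ℝ × ℝ → ℝ) : Prop :=
  Integrable ω (volume.restrict H) ∧
  ∃ A : Set (ℝ × ℝ), A ⊆ H ∧ MeasurableSet A ∧
    (∀ᵐ x ∂volume.restrict H, ω x = A.indicator (fun _ => (1 : ℝ)) x) ∧
    (∫ x in A, x.2) = M ∧ volume A ≤ 1

/-- The admissible class `K_{M,∞}`: patches `ω = 1_A` a.e. on `ℝ²₊` with
impulse `∫_A x₂ = M`, without any mass bound. -/
def memKinf (M : ℝ) (ω : ℝ × ℝ → ℝ) : Prop :=
  Integrable ω (volume.restrict H) ∧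
  ∃ A : Set (ℝ × ℝ), A ⊆ H ∧ MeasurableSet A ∧
    (∀ᵐ x ∂volume.restrict H, ω x = A.indicator (fun _ => (1 : ℝ)) x) ∧
    (∫ x in A, x.2) = M

/-- The relaxed admissible class `K̃_M`: measurable `0 ≤ ω ≤ 1` with
mass `≤ 1` and impulse `≤ M`. -/
def memKt (M : ℝ) (ω : ℝ × ℝ → ℝ) : Prop :=
  Integrable ω (volume.restrict H) ∧
  (∀ᵐ x ∂volume.restrict H, 0 ≤ ω x ∧ ω x ≤ 1) ∧
  norm1 ω ≤ 1 ∧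
  Integrable (fun x : ℝ × ℝ => x.2 * |ω x|) (volume.restrict H) ∧
  impulse ω ≤ M

/-- The set of maximizers `S_M` of the energy over `K_M`. -/
def memS (M : ℝ) (ω : ℝ × ℝ → ℝ) : Prop :=
  memK M ω ∧ ∀ ω' : ℝ × ℝ → ℝ, memK M ω' → energy ω' ≤ energy ω

/-- The maximal energy `I_M` over `K_M`. -/
def Isup (M : ℝ) : ℝ := sSup (energy '' {ω | memK M ω})

/-- The maximal energy `I_{1,∞}` over `K_{1,∞}`. -/
def IsupInf : ℝ := sSup (energy '' {ω | memKinf 1 ω})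

/-- The Steiner symmetry condition for a set `Ω ⊆ ℝ²₊`. -/
def SteinerSet (Ω : Set (ℝ × ℝ)) : Prop :=
  (∀ x₁ x₂ : ℝ, 0 < x₂ → (((x₁, x₂) : ℝ × ℝ) ∈ Ω ↔ ((-x₁, x₂) : ℝ × ℝ) ∈ Ω)) ∧
  (∀ x₂ : ℝ, 0 < x₂ → ∀ a b : ℝ, 0 ≤ a → a ≤ b →
    ((b, x₂) : ℝ × ℝ) ∈ Ω → ((a, x₂) : ℝ × ℝ) ∈ Ω)

/-- The Steiner symmetry condition for a nonnegative function on `ℝ²₊`. -/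
def SteinerFn (f : ℝ × ℝ → ℝ) : Prop :=
  (∀ x₁ x₂ : ℝ, 0 < x₂ → f (x₁, x₂) = f (-x₁, x₂)) ∧
  (∀ x₂ : ℝ, 0 < x₂ → ∀ a b : ℝ, 0 ≤ a → a ≤ b → f (b, x₂) ≤ f (a, x₂))

open scoped ENNReal

/-- The measure `x₂ dx` on the upper half plane, whose total mass on a patch is its impulse. -/
def impulseMeasure : Measure (ℝ × ℝ) := volume.withDensity fun x => ENNReal.ofReal x.2

/-- The Green kernel relative to `impulseMeasure`, namely `G(x,y) / (x₂ y₂)`. -/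
def greenKernel (x y : ℝ × ℝ) : ℝ≥0∞ := ENNReal.ofReal (G x y / (x.2 * y.2))

/-- The relative potential `𝒢[ω](x) / x₂`. -/
def relPot (ω : ℝ × ℝ → ℝ≥0∞) (x : ℝ × ℝ) : ℝ≥0∞ := ∫⁻ y, greenKernel x y * ω y ∂impulseMeasure

/-- Twice the kinetic energy. -/
def dblEnergy (ω : ℝ × ℝ → ℝ≥0∞) : ℝ≥0∞ := ∫⁻ x, relPot ω x * ω x ∂impulseMeasure

lemma measurable_G : Measurable (fun p : (ℝ × ℝ) × (ℝ × ℝ) => G p.1 p.2) := by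
  unfold G; fun_prop

@[fun_prop]
lemma Measurable.greenKernel {α : Type*} [MeasurableSpace α] {f g : α → ℝ × ℝ}
    (hf : Measurable f) (hg : Measurable g) : Measurable fun a => greenKernel (f a) (g a) := by
  have : Measurable fun a => G (f a) (g a) := measurable_G.comp (hf.prodMk hg)
  unfold _root_.greenKernel
  fun_prop

lemma measurableSet_H : MeasurableSet H := measurableSet_lt measurable_const measurable_snd

instance : SigmaFinite impulseMeasure :=
  SigmaFinite.withDensity_ofReal _

lemma lintegral_impulseMeasure (g : ℝ × ℝ → ℝ≥0∞) :
    ∫⁻ x, g x ∂impulseMeasure = ∫⁻ x, ENNReal.ofReal x.2 * g x := by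
  unfold impulseMeasure
  rw [lintegral_withDensity_eq_lintegral_mul_non_measurable _ (by fun_prop) (by simp)]
  simp

lemma ae_impulseMeasure_of_ae {p : ℝ × ℝ → Prop} (h : ∀ᵐ x, p x) : ∀ᵐ x ∂impulseMeasure, p x :=
  (withDensity_absolutelyContinuous _ _).ae_le h

lemma ae_mem_H : ∀ᵐ x ∂impulseMeasure, x ∈ H := by
  unfold impulseMeasure
  rw [ae_withDensity_iff (by fun_prop)]
  refine Eventually.of_forall fun x hx => ?_
  simpa [H] using hx

lemma ae_impulseMeasure_ne (x : ℝ × ℝ) : ∀ᵐ y ∂impulseMeasure, y ≠ x :=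
  ae_impulseMeasure_of_ae (by simp [ae_iff])

lemma volume_null_of_impulseMeasure_null {s : Set (ℝ × ℝ)} (hs : s ⊆ H)
    (h : impulseMeasure s = 0) : volume s = 0 := by
  have h1 : ∀ᵐ x ∂impulseMeasure, x ∉ s := by simpa [ae_iff] using h
  unfold impulseMeasure at h1
  rw [ae_withDensity_iff (by fun_prop)] at h1
  have h2 : ∀ᵐ x : ℝ × ℝ, x ∉ s := by
    filter_upwards [h1] with x hx hxs
    exact hx (by simpa [H] using hs hxs) hxs
  simpa [ae_iff] using h2

lemma relPot_measurable {ω : ℝ × ℝ → ℝ≥0∞} (hω : Measurable ω) : Measurable (relPot ω) := by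
  unfold relPot
  apply Measurable.lintegral_prod_right'
    (f := fun p : (ℝ × ℝ) × (ℝ × ℝ) => greenKernel p.1 p.2 * ω p.2)
  fun_prop

lemma relPot_mono {ω η : ℝ × ℝ → ℝ≥0∞} (h : ω ≤ η) (x : ℝ × ℝ) : relPot ω x ≤ relPot η x :=
  lintegral_mono fun y => mul_le_mul_right (h y) _

/-! ### Pointwise bounds on the kernel -/

lemma distSq_pos {x y : ℝ × ℝ} (h : y ≠ x) : 0 < (x.1 - y.1) ^ 2 + (x.2 - y.2) ^ 2 := by
  by_contra hc
  apply h
  have h1 : (x.1 - y.1) ^ 2 = 0 := by nlinarith [sq_nonneg (x.1 - y.1), sq_nonneg (x.2 - y.2)]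
  have h2 : (x.2 - y.2) ^ 2 = 0 := by nlinarith [sq_nonneg (x.1 - y.1), sq_nonneg (x.2 - y.2)]
  ext
  · linarith [pow_eq_zero_iff (two_ne_zero) |>.1 h1]
  · linarith [pow_eq_zero_iff (two_ne_zero) |>.1 h2]

lemma norm_sq_le_distSq (x y : ℝ × ℝ) : ‖x - y‖ ^ 2 ≤ (x.1 - y.1) ^ 2 + (x.2 - y.2) ^ 2 := by
  rw [Prod.norm_def]
  rcases max_cases ‖(x - y).1‖ ‖(x - y).2‖ with ⟨h, _⟩ | ⟨h, _⟩ <;> rw [h] <;>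
    simp only [Prod.fst_sub, Prod.snd_sub, Real.norm_eq_abs, sq_abs] <;>
    nlinarith [sq_nonneg (x.1 - y.1), sq_nonneg (x.2 - y.2)]

lemma G_nonneg {x y : ℝ × ℝ} (hx : x ∈ H) (hy : y ∈ H) : 0 ≤ G x y := by
  have hx' : 0 < x.2 := hx
  have hy' : 0 < y.2 := hy
  unfold G
  apply mul_nonneg (by positivity)
  apply Real.log_nonneg
  have : 0 ≤ 4 * x.2 * y.2 / ((x.1 - y.1) ^ 2 + (x.2 - y.2) ^ 2) := by positivity
  linarith

lemma G_pos {x y : ℝ × ℝ} (hx : x ∈ H) (hy : y ∈ H) (hne : y ≠ x) : 0 < G x y := by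
  have hx' : 0 < x.2 := hx
  have hy' : 0 < y.2 := hy
  have := distSq_pos hne
  unfold G
  apply mul_pos (by positivity)
  apply Real.log_pos
  have : 0 < 4 * x.2 * y.2 / ((x.1 - y.1) ^ 2 + (x.2 - y.2) ^ 2) := by positivity
  linarith

lemma G_comm (x y : ℝ × ℝ) : G x y = G y x := by
  unfold G
  ring_nf

lemma greenKernel_comm (x y : ℝ × ℝ) : greenKernel x y = greenKernel y x := by
  unfold greenKernel
  rw [G_comm, mul_comm]

lemma greenKernel_ne_top (x y : ℝ × ℝ) : greenKernel x y ≠ ⊤ := ENNReal.ofReal_ne_top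

lemma G_le_inv_sq {x y : ℝ × ℝ} (hx : x ∈ H) (hy : y ∈ H) (hne : y ≠ x) :
    G x y ≤ x.2 * y.2 / ‖x - y‖ ^ 2 := by
  have hx' : 0 < x.2 := hx
  have hy' : 0 < y.2 := hy
  have hd := distSq_pos hne
  have hn := norm_sq_le_distSq x y
  have hn0 : 0 < ‖x - y‖ := norm_pos_iff.2 (sub_ne_zero.2 hne.symm)
  set d := (x.1 - y.1) ^ 2 + (x.2 - y.2) ^ 2 with hd_def
  have h1 : Real.log (1 + 4 * x.2 * y.2 / d) ≤ 4 * x.2 * y.2 / d := by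
    have : 0 < 4 * x.2 * y.2 / d := by positivity
    have := Real.log_le_sub_one_of_pos (x := 1 + 4 * x.2 * y.2 / d) (by linarith)
    linarith
  have hpi : (1:ℝ) ≤ π := by linarith [Real.pi_gt_three]
  calc G x y ≤ (1 / (4 * π)) * (4 * x.2 * y.2 / d) := by
        unfold G; gcongr
    _ = x.2 * y.2 / (π * d) := by field_simp
    _ ≤ x.2 * y.2 / ‖x - y‖ ^ 2 := by
        gcongr
        nlinarith

lemma G_le_inv {x y : ℝ × ℝ} (hx : x ∈ H) (hy : y ∈ H) (hne : y ≠ x) :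
    G x y ≤ x.2 / ‖x - y‖ := by
  have hx' : 0 < x.2 := hx
  have hy' : 0 < y.2 := hy
  have hd := distSq_pos hne
  have hn := norm_sq_le_distSq x y
  have hn0 : 0 < ‖x - y‖ := norm_pos_iff.2 (sub_ne_zero.2 hne.symm)
  set r := ‖x - y‖ with hr
  have hyx : y.2 ≤ x.2 + r := by
    have : ‖(x - y).2‖ ≤ ‖x - y‖ := norm_snd_le _
    rw [Real.norm_eq_abs] at this
    have := (abs_le.1 this).1
    simp at this
    linarith
  have hle : 1 + 4 * x.2 * y.2 / ((x.1 - y.1) ^ 2 + (x.2 - y.2) ^ 2) ≤ (1 + 2 * x.2 / r) ^ 2 := by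
    calc 1 + 4 * x.2 * y.2 / ((x.1 - y.1) ^ 2 + (x.2 - y.2) ^ 2)
        ≤ 1 + 4 * x.2 * (x.2 + r) / r ^ 2 := by gcongr
      _ = (1 + 2 * x.2 / r) ^ 2 := by field_simp; ring
  have h1 : Real.log (1 + 4 * x.2 * y.2 / ((x.1 - y.1) ^ 2 + (x.2 - y.2) ^ 2)) ≤ 4 * x.2 / r := by
    have hp : 0 < 2 * x.2 / r := by positivity
    have hq : 0 < 4 * x.2 * y.2 / ((x.1 - y.1) ^ 2 + (x.2 - y.2) ^ 2) := by positivity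
    have h2 := Real.log_le_log (by linarith) hle
    rw [Real.log_pow] at h2
    have h3 := Real.log_le_sub_one_of_pos (x := 1 + 2 * x.2 / r) (by linarith)
    push_cast at h2
    have : 4 * x.2 / r = 2 * (2 * x.2 / r) := by ring
    rw [this]
    linarith
  have hpi : (1:ℝ) ≤ π := by linarith [Real.pi_gt_three]
  calc G x y ≤ (1 / (4 * π)) * (4 * x.2 / r) := by
        unfold G; gcongr
    _ = x.2 / (π * r) := by field_simp
    _ ≤ x.2 / r := by
        gcongr
        nlinarith

lemma greenKernel_le_inv_sq {x y : ℝ × ℝ} (hx : x ∈ H) (hy : y ∈ H) (hne : y ≠ x) :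
    greenKernel x y ≤ ENNReal.ofReal (1 / ‖x - y‖ ^ 2) := by
  have hx' : 0 < x.2 := hx
  have hy' : 0 < y.2 := hy
  have hn0 : 0 < ‖x - y‖ := norm_pos_iff.2 (sub_ne_zero.2 hne.symm)
  apply ENNReal.ofReal_le_ofReal
  rw [div_le_iff₀ (by positivity)]
  calc G x y ≤ _ := G_le_inv_sq hx hy hne
    _ = _ := by ring

lemma mul_greenKernel_le_inv {x y : ℝ × ℝ} (hx : x ∈ H) (hy : y ∈ H) (hne : y ≠ x) :
    ENNReal.ofReal y.2 * greenKernel x y ≤ ENNReal.ofReal (1 / ‖x - y‖) := by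
  have hx' : 0 < x.2 := hx
  have hy' : 0 < y.2 := hy
  have hn0 : 0 < ‖x - y‖ := norm_pos_iff.2 (sub_ne_zero.2 hne.symm)
  unfold greenKernel
  rw [← ENNReal.ofReal_mul hy'.le]
  apply ENNReal.ofReal_le_ofReal
  calc y.2 * (G x y / (x.2 * y.2)) = G x y / x.2 := by field_simp
    _ ≤ (x.2 / ‖x - y‖) / x.2 := by gcongr; exact G_le_inv hx hy hne
    _ = _ := by field_simp

lemma greenKernel_pos {x y : ℝ × ℝ} (hx : x ∈ H) (hy : y ∈ H) (hne : y ≠ x) :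
    0 < greenKernel x y := by
  have hx' : 0 < x.2 := hx
  have hy' : 0 < y.2 := hy
  have := G_pos hx hy hne
  exact ENNReal.ofReal_pos.2 (by positivity)

lemma ofReal_mul_greenKernel_mul {x y : ℝ × ℝ} (hx : x ∈ H) (hy : y ∈ H) :
    ENNReal.ofReal x.2 * (ENNReal.ofReal y.2 * greenKernel x y) = ENNReal.ofReal (G x y) := by
  have hx' : 0 < x.2 := hx
  have hy' : 0 < y.2 := hy
  unfold greenKernel
  rw [← ENNReal.ofReal_mul hy'.le, ← ENNReal.ofReal_mul hx'.le]
  congr 1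
  field_simp

/-! ### Uniform bounds on the potential -/

lemma lintegral_inv_norm_le (x : ℝ × ℝ) {r : ℝ} (hr : 0 < r) :
    ∫⁻ y in {y | ‖x - y‖ < r}, ENNReal.ofReal (1 / ‖x - y‖) ≤ ENNReal.ofReal (8 * r) := by
  set f : ℝ → ℝ := (Iio r).indicator fun s => 1 / s with hf
  have hcong : EqOn (fun y : ℝ => y ^ (Module.finrank ℝ (ℝ × ℝ) - 1) • f y)
      ((Iio r).indicator fun _ => 1) (Ioi 0) := by
    intro y hy
    have hy' : (0:ℝ) < y := hy
    by_cases h : y < r <;> simp [hf, h, hy'.ne']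
  have hint : Integrable (fun z : ℝ × ℝ => f ‖z‖) := by
    rw [integrable_fun_norm_addHaar, integrableOn_congr_fun hcong measurableSet_Ioi]
    rw [integrableOn_indicator_iff measurableSet_Iio]
    simp [Iio_inter_Ioi]
  have hball : (volume : Measure (ℝ × ℝ)).real (Metric.ball 0 1) = 4 := by
    have : Metric.ball (0 : ℝ × ℝ) 1 = Metric.ball 0 1 ×ˢ Metric.ball 0 1 := by
      rw [ball_prod_same]; rfl
    rw [Measure.real, this, Measure.volume_eq_prod, Measure.prod_prod, Real.volume_ball]
    rw [← ENNReal.ofReal_mul (by norm_num), ENNReal.toReal_ofReal (by norm_num)]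
    norm_num
  have hval : ∫ z : ℝ × ℝ, f ‖z‖ = 8 * r := by
    rw [integral_fun_norm_addHaar, setIntegral_congr_fun measurableSet_Ioi hcong, hball,
      setIntegral_indicator measurableSet_Iio]
    simp [Ioi_inter_Iio, hr.le]
    ring
  have hf0 : ∀ z : ℝ × ℝ, 0 ≤ f ‖z‖ := fun z => by
    by_cases h : ‖z‖ < r <;> simp [hf, h]
  rw [← hval, ofReal_integral_eq_lintegral_ofReal hint (Eventually.of_forall hf0),
    ← lintegral_sub_left_eq_self (fun z : ℝ × ℝ => ENNReal.ofReal (f ‖z‖)) x,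
    ← lintegral_indicator (measurableSet_lt (by fun_prop) (by fun_prop))]
  apply lintegral_mono
  intro y
  by_cases h : ‖x - y‖ < r <;> simp [hf, h]

lemma lintegral_inv_norm_cube_lt_top (x : ℝ × ℝ) {r : ℝ} (hr : 0 < r) :
    ∫⁻ y in {y | r ≤ ‖x - y‖}, ENNReal.ofReal (1 / ‖x - y‖ ^ 3) < ⊤ := by
  have h1 : ∫⁻ z : ℝ × ℝ, ENNReal.ofReal ((1 + ‖z‖) ^ (-(3:ℝ))) < ⊤ :=
    finite_integral_one_add_norm (by simp; norm_num)
  calc ∫⁻ y in {y | r ≤ ‖x - y‖}, ENNReal.ofReal (1 / ‖x - y‖ ^ 3)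
      ≤ ∫⁻ y in {y | r ≤ ‖x - y‖}, ENNReal.ofReal ((1 + 1 / r) ^ 3) *
          ENNReal.ofReal ((1 + ‖x - y‖) ^ (-(3:ℝ))) := by
        apply setLIntegral_mono (by fun_prop)
        intro y hy
        have hy' : r ≤ ‖x - y‖ := hy
        have hp : 0 < ‖x - y‖ := hr.trans_le hy'
        rw [← ENNReal.ofReal_mul (by positivity)]
        apply ENNReal.ofReal_le_ofReal
        rw [Real.rpow_neg (by positivity), ← div_eq_mul_inv]
        norm_cast
        rw [← div_pow, ← one_div_pow]
        refine pow_le_pow_left₀ (by positivity) ?_ 3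
        rw [div_le_div_iff₀ hp (by positivity)]
        have : 1 ≤ ‖x - y‖ / r := (one_le_div hr).2 hy'
        calc 1 * (1 + ‖x - y‖) ≤ ‖x - y‖ + ‖x - y‖ / r := by linarith
          _ = _ := by ring
    _ ≤ ∫⁻ y, ENNReal.ofReal ((1 + 1 / r) ^ 3) *
          ENNReal.ofReal ((1 + ‖x - y‖) ^ (-(3:ℝ))) := setLIntegral_le_lintegral _ _
    _ = ENNReal.ofReal ((1 + 1 / r) ^ 3) * ∫⁻ z : ℝ × ℝ, ENNReal.ofReal ((1 + ‖z‖) ^ (-(3:ℝ))) := by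
        rw [lintegral_const_mul _ (by fun_prop),
          lintegral_sub_left_eq_self (fun z : ℝ × ℝ => ENNReal.ofReal ((1 + ‖z‖) ^ (-(3:ℝ)))) x]
    _ < ⊤ := ENNReal.mul_lt_top ENNReal.ofReal_lt_top h1

lemma setLIntegral_impulseMeasure {s : Set (ℝ × ℝ)} (hs : MeasurableSet s) (g : ℝ × ℝ → ℝ≥0∞) :
    ∫⁻ x in s, g x ∂impulseMeasure = ∫⁻ x in s, ENNReal.ofReal x.2 * g x := by
  rw [← lintegral_indicator hs, lintegral_impulseMeasure, ← lintegral_indicator hs]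
  congr 1 with x
  by_cases hx : x ∈ s <;> simp [hx]

lemma setLIntegral_near_le {ω : ℝ × ℝ → ℝ≥0∞} (h1 : ∀ y, ω y ≤ 1) {x : ℝ × ℝ} (hx : x ∈ H)
    {r : ℝ} (hr : 0 < r) :
    ∫⁻ y in {y | ‖x - y‖ < r}, greenKernel x y * ω y ∂impulseMeasure ≤ ENNReal.ofReal (8 * r) := by
  refine le_trans ?_ (lintegral_inv_norm_le x hr)
  rw [setLIntegral_impulseMeasure (measurableSet_lt (by fun_prop) (by fun_prop))]
  apply lintegral_mono_ae
  have : ∀ᵐ y : ℝ × ℝ, y ≠ x := by simp [ae_iff]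
  filter_upwards [ae_restrict_of_ae this] with y hne
  by_cases hy : y ∈ H
  · calc ENNReal.ofReal y.2 * (greenKernel x y * ω y)
        ≤ ENNReal.ofReal y.2 * (greenKernel x y * 1) := by gcongr; exact h1 y
      _ ≤ _ := by rw [mul_one]; exact mul_greenKernel_le_inv hx hy hne
  · have : y.2 ≤ 0 := not_lt.1 hy
    simp [ENNReal.ofReal_of_nonpos this]

lemma setLIntegral_far_le {ω : ℝ × ℝ → ℝ≥0∞} (hω : Measurable ω) {x : ℝ × ℝ} (hx : x ∈ H)
    {r : ℝ} (hr : 0 < r) {s : Set (ℝ × ℝ)} (hs : MeasurableSet s) (hsr : ∀ y ∈ s, r ≤ ‖x - y‖) :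
    ∫⁻ y in s, greenKernel x y * ω y ∂impulseMeasure ≤
      ENNReal.ofReal (1 / r ^ 2) * ∫⁻ y in s, ω y ∂impulseMeasure := by
  rw [← lintegral_const_mul _ hω]
  apply lintegral_mono_ae
  filter_upwards [ae_restrict_mem hs, ae_restrict_of_ae ae_mem_H,
    ae_restrict_of_ae (ae_impulseMeasure_ne x)] with y hys hy hne
  gcongr
  refine (greenKernel_le_inv_sq hx hy hne).trans (ENNReal.ofReal_le_ofReal ?_)
  have := hsr y hys
  gcongr

lemma setLIntegral_far_high_le {ω : ℝ × ℝ → ℝ≥0∞} (hω : Measurable ω) {x : ℝ × ℝ} (hx : x ∈ H)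
    {r c : ℝ} (hr : 0 < r) (hc : 0 < c) {s : Set (ℝ × ℝ)} (hs : MeasurableSet s)
    (hsr : ∀ y ∈ s, r ≤ ‖x - y‖) (hsc : ∀ y ∈ s, c ≤ y.2) :
    ∫⁻ y in s, greenKernel x y * ω y ∂impulseMeasure ≤
      ENNReal.ofReal (1 / (c * r)) * ∫⁻ y in s, ω y ∂impulseMeasure := by
  rw [← lintegral_const_mul _ hω]
  apply lintegral_mono_ae
  filter_upwards [ae_restrict_mem hs, ae_restrict_of_ae ae_mem_H,
    ae_restrict_of_ae (ae_impulseMeasure_ne x)] with y hys hy hne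
  gcongr
  have h1 := hsr y hys
  have h2 := hsc y hys
  have hx' : 0 < x.2 := hx
  have hy' : 0 < y.2 := hy
  apply ENNReal.ofReal_le_ofReal
  calc G x y / (x.2 * y.2) ≤ (x.2 / ‖x - y‖) / (x.2 * y.2) := by gcongr; exact G_le_inv hx hy hne
    _ = 1 / (y.2 * ‖x - y‖) := by
      have : 0 < ‖x - y‖ := hr.trans_le h1
      field_simp
    _ ≤ _ := by gcongr

lemma relPot_split (ω : ℝ × ℝ → ℝ≥0∞) (x : ℝ × ℝ) (r : ℝ) :
    relPot ω x = ∫⁻ y in {y | ‖x - y‖ < r}, greenKernel x y * ω y ∂impulseMeasure +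
      ∫⁻ y in {y | r ≤ ‖x - y‖}, greenKernel x y * ω y ∂impulseMeasure := by
  have hm : MeasurableSet {y : ℝ × ℝ | ‖x - y‖ < r} :=
    measurableSet_lt (by fun_prop) (by fun_prop)
  unfold relPot
  rw [← lintegral_add_compl _ hm]
  congr 3
  ext y; simp

lemma relPot_le {ω : ℝ × ℝ → ℝ≥0∞} (hω : Measurable ω) (h1 : ∀ y, ω y ≤ 1) {x : ℝ × ℝ}
    (hx : x ∈ H) {r : ℝ} (hr : 0 < r) :
    relPot ω x ≤ ENNReal.ofReal (8 * r) +
      ENNReal.ofReal (1 / r ^ 2) * ∫⁻ y, ω y ∂impulseMeasure := by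
  rw [relPot_split ω x r]
  gcongr
  · exact setLIntegral_near_le h1 hx hr
  · refine (setLIntegral_far_le hω hx hr (s := {y | r ≤ ‖x - y‖})
      (measurableSet_le (by fun_prop) (by fun_prop)) fun y hy => hy).trans ?_
    exact mul_le_mul_right (setLIntegral_le_lintegral _ _) _

lemma relPot_le_nine {ω : ℝ × ℝ → ℝ≥0∞} (hω : Measurable ω) (h1 : ∀ y, ω y ≤ 1) {x : ℝ × ℝ}
    (hx : x ∈ H) (hP : ∫⁻ y, ω y ∂impulseMeasure ≤ 1) : relPot ω x ≤ 9 := by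
  refine (relPot_le hω h1 hx one_pos).trans ?_
  calc _ ≤ ENNReal.ofReal (8 * 1) + ENNReal.ofReal (1 / 1 ^ 2) * 1 := by gcongr
    _ = 9 := by norm_num

/-- Relaxed patches `0 ≤ ω ≤ 1` which are even and non-increasing in `|x₁|`. -/
structure IsSteiner (ω : ℝ × ℝ → ℝ≥0∞) : Prop where
  measurable : Measurable ω
  le_one : ∀ x, ω x ≤ 1
  anti : ∀ a b t : ℝ, |a| ≤ |b| → ω (b, t) ≤ ω (a, t)

lemma IsSteiner.strip_le {ω : ℝ × ℝ → ℝ≥0∞} (h : IsSteiner ω)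
    (hP : ∫⁻ y, ω y ∂impulseMeasure ≤ 1) {a w c : ℝ} (hc : 0 < c) (ha : c + w ≤ |a|) :
    ∫⁻ y in {y | |a - y.1| < w}, ω y ∂impulseMeasure ≤ ENNReal.ofReal (2 * w / c) := by
  set F : ℝ → ℝ≥0∞ := fun s => ∫⁻ t, ENNReal.ofReal t * ω (s, t) with hF
  have hm := h.measurable
  have hFanti : ∀ s s', |s| ≤ |s'| → F s' ≤ F s := fun s s' hs =>
    lintegral_mono fun t => mul_le_mul_right (h.anti s s' t hs) _
  have hFint : ∫⁻ s, F s ≤ 1 := by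
    rw [lintegral_impulseMeasure, Measure.volume_eq_prod, lintegral_prod _ (by fun_prop)] at hP
    exact hP
  have hFle : ∀ s, c ≤ |s| → F s ≤ ENNReal.ofReal (1 / c) := by
    intro s hs
    have : ENNReal.ofReal c * F s ≤ 1 := by
      calc ENNReal.ofReal c * F s = ∫⁻ _ in Ioo 0 c, F s := by simp [mul_comm]
        _ ≤ ∫⁻ s' in Ioo 0 c, F s' := by
            apply setLIntegral_mono' measurableSet_Ioo
            intro s' hs'
            apply hFanti
            rw [abs_of_pos hs'.1]
            exact hs'.2.le.trans hs
        _ ≤ ∫⁻ s, F s := setLIntegral_le_lintegral _ _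
        _ ≤ 1 := hFint
    rw [one_div, ENNReal.ofReal_inv_of_pos hc]
    exact (ENNReal.le_inv_iff_mul_le).2 (by rwa [mul_comm])
  have hset : MeasurableSet {y : ℝ × ℝ | |a - y.1| < w} :=
    measurableSet_lt (by fun_prop) (by fun_prop)
  rw [setLIntegral_impulseMeasure hset]
  have hS : {y : ℝ × ℝ | |a - y.1| < w} = Ioo (a - w) (a + w) ×ˢ univ := by
    ext y
    simp only [mem_ofPred_eq, mem_prod, mem_Ioo, mem_univ, and_true, abs_lt]
    constructor <;> rintro ⟨h1, h2⟩ <;> constructor <;> linarith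
  rw [hS, Measure.volume_eq_prod, setLIntegral_prod _ (by fun_prop)]
  calc ∫⁻ s in Ioo (a - w) (a + w), ∫⁻ t in univ, ENNReal.ofReal t * ω (s, t)
      ≤ ∫⁻ s in Ioo (a - w) (a + w), ENNReal.ofReal (1 / c) := by
        apply setLIntegral_mono' measurableSet_Ioo
        intro s hs
        rw [Measure.restrict_univ]
        apply hFle
        have h1 : |a - s| < w := by rw [abs_lt]; constructor <;> linarith [hs.1, hs.2]
        have := abs_sub_abs_le_abs_sub a s
        linarith
    _ = ENNReal.ofReal (2 * w / c) := by
        rw [setLIntegral_const, Real.volume_Ioo, ← ENNReal.ofReal_mul (by positivity)]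
        congr 1
        ring

lemma exists_relPot_tail {ε : ℝ} (hε : 0 < ε) : ∃ A : ℝ, 0 < A ∧ ∀ ω, IsSteiner ω →
    ∫⁻ y, ω y ∂impulseMeasure ≤ 1 → ∀ x ∈ H, (A ≤ |x.1| ∨ A ≤ x.2) →
      relPot ω x ≤ ENNReal.ofReal ε := by
  set r := ε / 32 with hr_def
  have hr : 0 < r := by positivity
  set w := 1 + 4 / ε with hw_def
  have hw : 0 < w := by positivity
  have hw2 : 1 / w ^ 2 ≤ ε / 4 := by
    rw [div_le_div_iff₀ (by positivity) (by norm_num)]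
    have : ε * w = ε + 4 := by rw [hw_def]; field_simp
    have h1 : 1 ≤ w := by rw [hw_def]; linarith [show 0 < 4 / ε by positivity]
    nlinarith [mul_pos hε hw]
  refine ⟨w + 4 / (ε * r) + 8 * w / (ε * r ^ 2), by positivity, ?_⟩
  intro ω h hP x hx hA
  have hm := h.measurable
  have hset : ∀ s : ℝ, MeasurableSet {y : ℝ × ℝ | s ≤ ‖x - y‖} := fun s =>
    measurableSet_le (by fun_prop) (by fun_prop)
  have hset' : MeasurableSet {y : ℝ × ℝ | ‖x - y‖ < w} :=
    measurableSet_lt (by fun_prop) (by fun_prop)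
  have hsplit : ∫⁻ y in {y | r ≤ ‖x - y‖}, greenKernel x y * ω y ∂impulseMeasure ≤
      ∫⁻ y in {y | r ≤ ‖x - y‖} ∩ {y | ‖x - y‖ < w}, greenKernel x y * ω y ∂impulseMeasure +
      ∫⁻ y in {y | w ≤ ‖x - y‖}, greenKernel x y * ω y ∂impulseMeasure := by
    refine (lintegral_mono_set ?_).trans (lintegral_union_le _ _ _)
    intro y hy
    rcases lt_or_ge ‖x - y‖ w with h | h
    · exact Or.inl ⟨hy, h⟩
    · exact Or.inr h
  have hfar : ∫⁻ y in {y | w ≤ ‖x - y‖}, greenKernel x y * ω y ∂impulseMeasure ≤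
      ENNReal.ofReal (ε / 4) := by
    refine (setLIntegral_far_le hm hx hw (hset w) fun y hy => hy).trans ?_
    calc _ ≤ ENNReal.ofReal (ε / 4) * 1 := by
          gcongr
          exact (setLIntegral_le_lintegral _ _).trans hP
      _ = _ := mul_one _
  have hmid : ∫⁻ y in {y | r ≤ ‖x - y‖} ∩ {y | ‖x - y‖ < w}, greenKernel x y * ω y ∂impulseMeasure
      ≤ ENNReal.ofReal (ε / 4) := by
    have hp1 : 0 < 4 / (ε * r) := by positivity
    have hp2 : 0 < 8 * w / (ε * r ^ 2) := by positivity
    rcases hA with hA | hA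
    · refine (setLIntegral_far_le hm hx hr ((hset r).inter hset') fun y hy => hy.1).trans ?_
      have hstrip := h.strip_le hP (a := x.1) (w := w) (c := 8 * w / (ε * r ^ 2)) hp2
        (by linarith)
      calc _ ≤ ENNReal.ofReal (1 / r ^ 2) * ENNReal.ofReal (2 * w / (8 * w / (ε * r ^ 2))) := by
            gcongr
            refine (lintegral_mono_set ?_).trans hstrip
            intro y hy
            have h1 : ‖(x - y).1‖ ≤ ‖x - y‖ := norm_fst_le _
            exact lt_of_le_of_lt h1 hy.2
        _ = ENNReal.ofReal (ε / 4) := by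
            rw [← ENNReal.ofReal_mul (by positivity)]
            congr 1
            field_simp
            norm_num
    · refine (setLIntegral_far_high_le hm hx hr hp1 ((hset r).inter hset') (fun y hy => hy.1)
        ?_).trans ?_
      · intro y hy
        have h1 : ‖(x - y).2‖ ≤ ‖x - y‖ := norm_snd_le _
        have h2 : |x.2 - y.2| < w := lt_of_le_of_lt h1 hy.2
        rw [abs_lt] at h2
        linarith [h2.2]
      · calc _ ≤ ENNReal.ofReal (1 / (4 / (ε * r) * r)) * 1 := by
              gcongr
              exact (setLIntegral_le_lintegral _ _).trans hP
          _ = ENNReal.ofReal (ε / 4) := by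
              rw [mul_one]
              congr 1
              field_simp
  calc relPot ω x ≤ ENNReal.ofReal (8 * r) + (ENNReal.ofReal (ε / 4) + ENNReal.ofReal (ε / 4)) := by
        rw [relPot_split ω x r]
        gcongr
        · exact setLIntegral_near_le h.le_one hx hr
        · exact hsplit.trans (add_le_add hmid hfar)
    _ ≤ ENNReal.ofReal ε := by
        rw [← ENNReal.ofReal_add (by positivity) (by positivity),
          ← ENNReal.ofReal_add (by positivity) (by positivity)]
        apply ENNReal.ofReal_le_ofReal
        rw [hr_def]; linarith

/-! ### Reflections and dilations -/

/-- Reflection across the vertical line `x₁ = m`. -/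
def vertRefl (m : ℝ) (y : ℝ × ℝ) : ℝ × ℝ := (2 * m - y.1, y.2)

@[fun_prop]
lemma measurable_vertRefl (m : ℝ) : Measurable (vertRefl m) := by unfold vertRefl; fun_prop

@[simp]
lemma vertRefl_vertRefl (m : ℝ) (y : ℝ × ℝ) : vertRefl m (vertRefl m y) = y := by
  simp [vertRefl]

lemma measurePreserving_vertRefl_volume (m : ℝ) :
    MeasurePreserving (vertRefl m) (volume : Measure (ℝ × ℝ)) volume := by
  have h := (Measure.measurePreserving_sub_left (volume : Measure ℝ) (2 * m)).prod
    (MeasurePreserving.id (volume : Measure ℝ))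
  exact h

lemma measurePreserving_vertRefl (m : ℝ) :
    MeasurePreserving (vertRefl m) impulseMeasure impulseMeasure := by
  refine ⟨by fun_prop, Measure.ext_of_lintegral _ fun g hg => ?_⟩
  rw [lintegral_map hg (by fun_prop), lintegral_impulseMeasure, lintegral_impulseMeasure]
  exact (measurePreserving_vertRefl_volume m).lintegral_comp
    (f := fun x => ENNReal.ofReal x.2 * g x) (by fun_prop)

lemma mul_add_mul_le_of_le {p q u v : ℝ≥0∞} (h1 : q ≤ p) (h2 : v ≤ u) :
    p * v + q * u ≤ p * u + q * v := by
  obtain ⟨e, rfl⟩ := exists_add_of_le h1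
  calc (q + e) * v + q * u = q * u + e * v + q * v := by ring
    _ ≤ q * u + e * u + q * v := by gcongr
    _ = _ := by ring

section Rearrangement

variable {X : Type*} [MeasurableSpace X] {μ : Measure X} {R : X → X} {p u : X → ℝ≥0∞}

lemma two_mul_lintegral_mul_comp (hR : MeasurePreserving R μ μ) (hRR : ∀ x, R (R x) = x)
    (hp : Measurable p) (hu : Measurable u) :
    ∫⁻ x, (p x * u (R x) + p (R x) * u x) ∂μ = 2 * ∫⁻ x, p (R x) * u x ∂μ ∧
    ∫⁻ x, (p x * u x + p (R x) * u (R x)) ∂μ = 2 * ∫⁻ x, p x * u x ∂μ := by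
  have hRm := hR.measurable
  constructor
  · rw [lintegral_add_left (by fun_prop), two_mul]
    congr 1
    rw [← hR.lintegral_comp (by fun_prop)]
    simp [hRR]
  · rw [lintegral_add_left (by fun_prop), two_mul]
    congr 1
    exact hR.lintegral_comp (f := fun x => p x * u x) (by fun_prop)

lemma lintegral_comp_mul_le (hR : MeasurePreserving R μ μ) (hRR : ∀ x, R (R x) = x)
    (hp : Measurable p) (hu : Measurable u)
    (h : ∀ᵐ x ∂μ, p x * u (R x) + p (R x) * u x ≤ p x * u x + p (R x) * u (R x)) :
    ∫⁻ x, p (R x) * u x ∂μ ≤ ∫⁻ x, p x * u x ∂μ := by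
  obtain ⟨h1, h2⟩ := two_mul_lintegral_mul_comp hR hRR hp hu
  have := lintegral_mono_ae h
  rw [h1, h2] at this
  exact (ENNReal.mul_le_mul_iff_right two_ne_zero ENNReal.ofNat_ne_top).1 this

lemma ae_eq_of_lintegral_comp_mul_eq (hR : MeasurePreserving R μ μ) (hRR : ∀ x, R (R x) = x)
    (hp : Measurable p) (hu : Measurable u)
    (h : ∀ᵐ x ∂μ, p x * u (R x) + p (R x) * u x ≤ p x * u x + p (R x) * u (R x))
    (heq : ∫⁻ x, p (R x) * u x ∂μ = ∫⁻ x, p x * u x ∂μ) (hfin : ∫⁻ x, p x * u x ∂μ ≠ ⊤) :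
    ∀ᵐ x ∂μ, p x * u (R x) + p (R x) * u x = p x * u x + p (R x) * u (R x) := by
  obtain ⟨h1, h2⟩ := two_mul_lintegral_mul_comp hR hRR hp hu
  have hRm := hR.measurable
  refine ae_eq_of_ae_le_of_lintegral_le h ?_ (by fun_prop) ?_
  · rw [h1, heq]
    exact ENNReal.mul_ne_top ENNReal.ofNat_ne_top hfin
  · rw [h1, h2, heq]

end Rearrangement

lemma greenKernel_le_of_abs_le {a b t : ℝ} {y : ℝ × ℝ} (ht : 0 < t) (hy : y ∈ H)
    (hne : y ≠ (a, t)) (h : |a - y.1| ≤ |b - y.1|) :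
    greenKernel (b, t) y ≤ greenKernel (a, t) y := by
  have hy' : 0 < y.2 := hy
  have hd := distSq_pos hne
  have h2 := sq_le_sq.2 h
  apply ENNReal.ofReal_le_ofReal
  unfold G
  simp only at hd ⊢
  have : 0 ≤ 4 * t * y.2 / ((b - y.1) ^ 2 + (t - y.2) ^ 2) := by positivity
  gcongr

lemma greenKernel_lt_of_abs_lt {a b t : ℝ} {y : ℝ × ℝ} (ht : 0 < t) (hy : y ∈ H)
    (hne : y ≠ (a, t)) (h : |a - y.1| < |b - y.1|) :
    greenKernel (b, t) y < greenKernel (a, t) y := by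
  have hy' : 0 < y.2 := hy
  have hd := distSq_pos hne
  have h2 := sq_lt_sq.2 h
  have hpos : (0 : ℝ) < G (a, t) y / ((a, t).2 * y.2) := by
    have := G_pos (x := (a, t)) ht hy hne
    positivity
  refine (ENNReal.ofReal_lt_ofReal_iff hpos).2 ?_
  unfold G
  simp only at hd ⊢
  have : 0 ≤ 4 * t * y.2 / ((b - y.1) ^ 2 + (t - y.2) ^ 2) := by positivity
  gcongr

lemma greenKernel_vertRefl (a b t : ℝ) (y : ℝ × ℝ) :
    greenKernel (a, t) (vertRefl ((a + b) / 2) y) = greenKernel (b, t) y := by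
  unfold greenKernel G vertRefl
  simp only
  congr 6
  ring

/-- The Steiner property in almost-everywhere form. -/
def AESteiner (u : ℝ × ℝ → ℝ≥0∞) : Prop :=
  ∀ m : ℝ, ∀ᵐ y ∂impulseMeasure, |y.1| ≤ |2 * m - y.1| → u (vertRefl m y) ≤ u y

lemma IsSteiner.aeSteiner {u : ℝ × ℝ → ℝ≥0∞} (h : IsSteiner u) : AESteiner u :=
  fun m => Eventually.of_forall fun y hy => h.anti y.1 (2 * m - y.1) y.2 hy

lemma AESteiner.symm_le {u : ℝ × ℝ → ℝ≥0∞} (h : AESteiner u) (m : ℝ) :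
    ∀ᵐ y ∂impulseMeasure, |2 * m - y.1| ≤ |y.1| → u y ≤ u (vertRefl m y) := by
  filter_upwards [(measurePreserving_vertRefl m).quasiMeasurePreserving.ae (h m)] with y hy hle
  have := hy (by simpa [vertRefl] using hle)
  simpa using this

lemma AESteiner.rearrangement {u : ℝ × ℝ → ℝ≥0∞} (h : AESteiner u) {a b t : ℝ} (ht : 0 < t)
    (hab : |a| ≤ |b|) :
    ∀ᵐ y ∂impulseMeasure,
      greenKernel (a, t) y * u (vertRefl ((a + b) / 2) y) +
        greenKernel (a, t) (vertRefl ((a + b) / 2) y) * u y ≤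
      greenKernel (a, t) y * u y +
        greenKernel (a, t) (vertRefl ((a + b) / 2) y) * u (vertRefl ((a + b) / 2) y) := by
  rcases eq_or_ne a b with rfl | hne
  · have : ∀ y, vertRefl ((a + a) / 2) y = (2 * a - y.1, y.2) := fun y => by
      simp [vertRefl]
    filter_upwards with y
    rw [greenKernel_vertRefl a a t y, add_comm]
  have hsq : 0 ≤ (b - a) * (a + b) := by nlinarith [sq_le_sq.2 hab]
  have hba : 0 < (b - a) ^ 2 := by
    have : b - a ≠ 0 := sub_ne_zero.2 hne.symm
    positivity
  filter_upwards [h ((a + b) / 2), h.symm_le ((a + b) / 2), ae_mem_H,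
    ae_impulseMeasure_ne (a, t), ae_impulseMeasure_ne (b, t)] with y h1 h2 hy hna hnb
  rw [greenKernel_vertRefl a b t y]
  rcases le_total 0 ((b - a) * (a + b - 2 * y.1)) with hs | hs
  · refine mul_add_mul_le_of_le (greenKernel_le_of_abs_le ht hy hna (sq_le_sq.1 (by nlinarith)))
      (h1 (sq_le_sq.1 ?_))
    have h3 : 0 ≤ (b - a) ^ 2 * ((a + b) * (a + b - 2 * y.1)) := by
      nlinarith [mul_nonneg hsq hs]
    have h4 := nonneg_of_mul_nonneg_right h3 hba
    nlinarith
  · have key := mul_add_mul_le_of_le (greenKernel_le_of_abs_le ht hy hnb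
      (show |b - y.1| ≤ |a - y.1| from sq_le_sq.1 (by nlinarith)))
      (h2 (sq_le_sq.1 ?_))
    · calc _ = _ := add_comm _ _
        _ ≤ _ := key
        _ = _ := add_comm _ _
    have h3 : 0 ≤ (b - a) ^ 2 * ((a + b) * (-(a + b - 2 * y.1))) := by
      nlinarith [mul_nonneg hsq (neg_nonneg.2 hs)]
    have h4 := nonneg_of_mul_nonneg_right h3 hba
    nlinarith

lemma AESteiner.relPot_anti {u : ℝ × ℝ → ℝ≥0∞} (h : AESteiner u) (hu : Measurable u) {a b t : ℝ}
    (ht : 0 < t) (hab : |a| ≤ |b|) : relPot u (b, t) ≤ relPot u (a, t) := by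
  have := lintegral_comp_mul_le (measurePreserving_vertRefl ((a + b) / 2))
    (vertRefl_vertRefl _) (p := greenKernel (a, t)) (by fun_prop) hu (h.rearrangement ht hab)
  simpa only [greenKernel_vertRefl, relPot] using this

lemma ae_fst_ne (m : ℝ) : ∀ᵐ y ∂impulseMeasure, y.1 ≠ m := by
  apply ae_impulseMeasure_of_ae
  have : {y : ℝ × ℝ | ¬ y.1 ≠ m} = {m} ×ˢ univ := by ext y; simp
  rw [ae_iff, this, Measure.volume_eq_prod, Measure.prod_prod]
  simp

lemma AESteiner.even {u : ℝ × ℝ → ℝ≥0∞} (h : AESteiner u) :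
    ∀ᵐ y ∂impulseMeasure, u (vertRefl 0 y) = u y := by
  filter_upwards [h 0, h.symm_le 0] with y h1 h2
  exact le_antisymm (h1 (by simp)) (h2 (by simp))

lemma AESteiner.symm_of_relPot_eq {u : ℝ × ℝ → ℝ≥0∞} (h : AESteiner u) (hu : Measurable u)
    (hu1 : ∀ y, u y ≤ 1) {a b t : ℝ} (ht : 0 < t) (hab : |a| ≤ |b|) (hne : a ≠ b)
    (heq : relPot u (a, t) = relPot u (b, t)) (hfin : relPot u (a, t) ≠ ⊤) :
    ∀ᵐ y ∂impulseMeasure, u (vertRefl ((a + b) / 2) y) = u y := by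
  have := ae_eq_of_lintegral_comp_mul_eq (measurePreserving_vertRefl ((a + b) / 2))
    (vertRefl_vertRefl _) (p := greenKernel (a, t)) (by fun_prop) hu (h.rearrangement ht hab)
    (by simpa only [greenKernel_vertRefl, relPot] using heq.symm) hfin
  filter_upwards [this, ae_mem_H, ae_impulseMeasure_ne (a, t), ae_impulseMeasure_ne (b, t),
    ae_fst_ne ((a + b) / 2)] with y hy hyH hna hnb hm
  rw [greenKernel_vertRefl] at hy
  have hK : greenKernel (a, t) y ≠ greenKernel (b, t) y := by
    have : |a - y.1| ≠ |b - y.1| := by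
      intro hc
      rcases abs_eq_abs.1 hc with h1 | h1
      · exact hne (by linarith)
      · exact hm (by linarith)
    rcases this.lt_or_gt with h1 | h1
    · exact (greenKernel_lt_of_abs_lt ht hyH hna h1).ne'
    · exact (greenKernel_lt_of_abs_lt ht hyH hnb h1).ne
  have hf1 : u y ≠ ⊤ := ne_top_of_le_ne_top ENNReal.one_ne_top (hu1 _)
  have hf2 : u (vertRefl ((a + b) / 2) y) ≠ ⊤ := ne_top_of_le_ne_top ENNReal.one_ne_top (hu1 _)
  generalize u (vertRefl ((a + b) / 2) y) = v at *
  generalize u y = w at *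
  have hk1 := greenKernel_ne_top (a, t) y
  have hk2 := greenKernel_ne_top (b, t) y
  generalize greenKernel (a, t) y = p at *
  generalize greenKernel (b, t) y = q at *
  lift v to ℝ≥0 using hf2
  lift w to ℝ≥0 using hf1
  lift p to ℝ≥0 using hk1
  lift q to ℝ≥0 using hk2
  norm_cast at *
  have h1 : (p : ℝ) * v + q * w = p * w + q * v := by exact_mod_cast hy
  have h2 : ((p : ℝ) - q) * (v - w) = 0 := by linarith
  rcases mul_eq_zero.1 h2 with h3 | h3
  · exact absurd (by exact_mod_cast sub_eq_zero.1 h3) hK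
  · exact_mod_cast sub_eq_zero.1 h3

/-- Two distinct vertical symmetry axes are incompatible with a bounded support. -/
lemma AESteiner.lintegral_eq_zero {u : ℝ × ℝ → ℝ≥0∞} (h : AESteiner u) (hu : Measurable u)
    (hfin : ∫⁻ y, u y ∂impulseMeasure ≠ ⊤) {A m : ℝ} (hm : 0 < m)
    (hA : ∀ᵐ y ∂impulseMeasure, A < |y.1| → u y = 0)
    (hsymm : ∀ᵐ y ∂impulseMeasure, u (vertRefl m y) = u y) :
    ∫⁻ y, u y ∂impulseMeasure = 0 := by
  have h0 : ∫⁻ y, ENNReal.ofReal (A - y.1) * u y ∂impulseMeasure =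
      ∫⁻ y, ENNReal.ofReal (A + y.1) * u y ∂impulseMeasure := by
    rw [← (measurePreserving_vertRefl 0).lintegral_comp (by fun_prop)]
    apply lintegral_congr_ae
    filter_upwards [h.even] with y hy
    rw [hy]; simp [vertRefl]
  have h1 : ∫⁻ y, ENNReal.ofReal (A + y.1) * u y ∂impulseMeasure =
      ∫⁻ y, ENNReal.ofReal (A - y.1) * u y ∂impulseMeasure +
      ENNReal.ofReal (2 * m) * ∫⁻ y, u y ∂impulseMeasure := by
    rw [← (measurePreserving_vertRefl m).lintegral_comp (by fun_prop),
      ← lintegral_const_mul _ hu, ← lintegral_add_left (by fun_prop)]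
    apply lintegral_congr_ae
    filter_upwards [hsymm, hA] with y hy hyA
    rw [hy]
    by_cases hc : A < |y.1|
    · simp [hyA hc]
    · have := abs_le.1 (not_lt.1 hc)
      rw [← add_mul, ← ENNReal.ofReal_add (by linarith [this.2]) (by linarith)]
      congr 2
      simp only [vertRefl]
      ring
  have h2 : ∫⁻ y, ENNReal.ofReal (A - y.1) * u y ∂impulseMeasure ≠ ⊤ := by
    refine ne_top_of_le_ne_top (ENNReal.mul_ne_top (ENNReal.ofReal_ne_top (r := 2 * A)) hfin) ?_
    rw [← lintegral_const_mul _ hu]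
    apply lintegral_mono_ae
    filter_upwards [hA] with y hyA
    by_cases hc : A < |y.1|
    · simp [hyA hc]
    · have := abs_le.1 (not_lt.1 hc)
      gcongr
      linarith [this.1]
  rw [h1] at h0
  have h3 : ENNReal.ofReal (2 * m) * ∫⁻ y, u y ∂impulseMeasure = 0 := by
    have := h0
    nth_rewrite 1 [← add_zero (∫⁻ y, ENNReal.ofReal (A - y.1) * u y ∂impulseMeasure)] at this
    exact ((ENNReal.add_right_inj h2).1 this).symm
  rcases mul_eq_zero.1 h3 with h4 | h4
  · simp at h4; linarith
  · exact h4

lemma lintegral_comp_smul_impulseMeasure {g : ℝ × ℝ → ℝ≥0∞} (hg : Measurable g) {s : ℝ}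
    (hs : 0 < s) :
    ∫⁻ y, g (s • y) ∂impulseMeasure =
      ENNReal.ofReal (s⁻¹ ^ 3) * ∫⁻ y, g y ∂impulseMeasure := by
  have hvol : ∀ k : ℝ × ℝ → ℝ≥0∞, Measurable k →
      ∫⁻ y, k (s • y) = ENNReal.ofReal (s⁻¹ ^ 2) * ∫⁻ y, k y := by
    intro k hk
    rw [← lintegral_map hk (measurable_const_smul s), Measure.map_addHaar_smul _ hs.ne',
      lintegral_smul_measure]
    simp [abs_of_pos hs]
  rw [lintegral_impulseMeasure, lintegral_impulseMeasure]
  have h1 : ∀ y : ℝ × ℝ, ENNReal.ofReal y.2 * g (s • y) =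
      ENNReal.ofReal s⁻¹ * (ENNReal.ofReal (s • y).2 * g (s • y)) := by
    intro y
    rw [← mul_assoc, ← ENNReal.ofReal_mul (by positivity)]
    congr 2
    simp; field_simp
  simp_rw [h1]
  rw [lintegral_const_mul _ (by fun_prop),
    hvol (fun y => ENNReal.ofReal y.2 * g y) (by fun_prop), ← mul_assoc,
    ← ENNReal.ofReal_mul (by positivity)]
  congr 2
  ring

lemma greenKernel_smul (x y : ℝ × ℝ) {s : ℝ} (hs : 0 < s) :
    greenKernel (s • x) (s • y) = ENNReal.ofReal (s⁻¹ ^ 2) * greenKernel x y := by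
  unfold greenKernel
  rw [← ENNReal.ofReal_mul (by positivity)]
  congr 1
  have hG : G (s • x) (s • y) = G x y := by
    unfold G
    have : 4 * (s • x).2 * (s • y).2 / (((s • x).1 - (s • y).1) ^ 2 + ((s • x).2 - (s • y).2) ^ 2)
        = (s ^ 2 * (4 * x.2 * y.2)) / (s ^ 2 * ((x.1 - y.1) ^ 2 + (x.2 - y.2) ^ 2)) := by
      simp only [Prod.smul_fst, Prod.smul_snd, smul_eq_mul]
      congr 1 <;> ring
    rw [this, mul_div_mul_left _ _ (by positivity)]
  rw [hG]
  simp only [Prod.smul_snd, smul_eq_mul]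
  by_cases h : x.2 * y.2 = 0
  · have : s * x.2 * (s * y.2) = 0 := by rw [show s * x.2 * (s * y.2) = s ^ 2 * (x.2 * y.2) by ring, h, mul_zero]
    rw [this, h]; simp
  · have : s * x.2 * (s * y.2) = s ^ 2 * (x.2 * y.2) := by ring
    rw [this]
    field_simp

lemma dblEnergy_comp_smul {ω : ℝ × ℝ → ℝ≥0∞} (hω : Measurable ω) {s : ℝ} (hs : 0 < s) :
    dblEnergy (fun y => ω (s • y)) = ENNReal.ofReal (s⁻¹ ^ 4) * dblEnergy ω := by
  have hpot : ∀ x, relPot (fun y => ω (s • y)) x = ENNReal.ofReal s⁻¹ * relPot ω (s • x) := by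
    intro x
    unfold relPot
    have h1 : ∀ y, greenKernel x y * ω (s • y) =
        ENNReal.ofReal (s ^ 2) * (greenKernel (s • x) (s • y) * ω (s • y)) := by
      intro y
      rw [greenKernel_smul x y hs, ← mul_assoc, ← mul_assoc, ← ENNReal.ofReal_mul (by positivity)]
      rw [show s ^ 2 * s⁻¹ ^ 2 = 1 by field_simp]
      simp
    simp_rw [h1]
    rw [lintegral_const_mul _ (by fun_prop), lintegral_comp_smul_impulseMeasure
      (g := fun y => greenKernel (s • x) y * ω y) (by fun_prop) hs, ← mul_assoc,
      ← ENNReal.ofReal_mul (by positivity)]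
    congr 2
    field_simp
  have hm := relPot_measurable hω
  unfold dblEnergy
  simp_rw [hpot, mul_assoc]
  rw [lintegral_const_mul _ (by fun_prop), lintegral_comp_smul_impulseMeasure
      (g := fun y => relPot ω y * ω y) (by fun_prop) hs, ← mul_assoc,
      ← ENNReal.ofReal_mul (by positivity)]
  congr 2
  ring

/-- The supremum of twice the kinetic energy over relaxed Steiner patches of impulse at most one. -/
def maxDblEnergy : ℝ≥0∞ :=
  ⨆ ω : {ω : ℝ × ℝ → ℝ≥0∞ // IsSteiner ω ∧ ∫⁻ y, ω y ∂impulseMeasure ≤ 1}, dblEnergy ω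

lemma IsSteiner.comp_smul {ω : ℝ × ℝ → ℝ≥0∞} (h : IsSteiner ω) {s : ℝ} :
    IsSteiner fun y => ω (s • y) where
  measurable := h.measurable.comp (measurable_const_smul s)
  le_one _ := h.le_one _
  anti a b t hab := by
    simp only [Prod.smul_mk, smul_eq_mul]
    apply h.anti
    rw [abs_mul, abs_mul]
    gcongr

lemma IsSteiner.dblEnergy_le {ω : ℝ × ℝ → ℝ≥0∞} (h : IsSteiner ω) {s : ℝ} (hs : 0 < s)
    (hP : ∫⁻ y, ω y ∂impulseMeasure ≤ ENNReal.ofReal (s ^ 3)) :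
    dblEnergy ω ≤ ENNReal.ofReal (s ^ 4) * maxDblEnergy := by
  have hP' : ∫⁻ y, ω (s • y) ∂impulseMeasure ≤ 1 := by
    rw [lintegral_comp_smul_impulseMeasure h.measurable hs]
    calc _ ≤ ENNReal.ofReal (s⁻¹ ^ 3) * ENNReal.ofReal (s ^ 3) := by gcongr
      _ = 1 := by
        rw [← ENNReal.ofReal_mul (by positivity), ← mul_pow, inv_mul_cancel₀ hs.ne']
        simp
  have h1 : dblEnergy (fun y => ω (s • y)) ≤ maxDblEnergy :=
    le_iSup (fun ω : {ω : ℝ × ℝ → ℝ≥0∞ // IsSteiner ω ∧ ∫⁻ y, ω y ∂impulseMeasure ≤ 1} =>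
      dblEnergy ω) ⟨_, h.comp_smul (s := s), hP'⟩
  calc dblEnergy ω = ENNReal.ofReal (s ^ 4) * dblEnergy (fun y => ω (s • y)) := by
        rw [dblEnergy_comp_smul h.measurable hs, ← mul_assoc, ← ENNReal.ofReal_mul (by positivity),
          ← mul_pow, mul_inv_cancel₀ hs.ne']
        simp
    _ ≤ _ := by gcongr

lemma maxDblEnergy_le : maxDblEnergy ≤ 9 := by
  refine iSup_le fun ⟨ω, h, hP⟩ => ?_
  calc dblEnergy ω ≤ ∫⁻ x, 9 * ω x ∂impulseMeasure := by
        apply lintegral_mono_ae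
        filter_upwards [ae_mem_H] with x hx
        gcongr
        exact relPot_le_nine h.measurable h.le_one hx hP
    _ = 9 * ∫⁻ x, ω x ∂impulseMeasure := lintegral_const_mul _ h.measurable
    _ ≤ 9 * 1 := by gcongr
    _ = 9 := by norm_num

lemma maxDblEnergy_pos : 0 < maxDblEnergy := by
  set s : Set (ℝ × ℝ) := Icc (-1) 1 ×ˢ Ioo 0 1 with hs
  have hsm : MeasurableSet s := measurableSet_Icc.prod measurableSet_Ioo
  have hst : IsSteiner (s.indicator 1) := by
    refine ⟨measurable_one.indicator hsm, fun x => indicator_le_self' (by simp) x, ?_⟩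
    intro a b t hab
    by_cases hb : (b, t) ∈ s
    · have ha : (a, t) ∈ s := by
        refine ⟨?_, hb.2⟩
        have : |b| ≤ 1 := abs_le.2 hb.1
        exact abs_le.1 (hab.trans this)
      simp [ha, hb]
    · simp [hb]
  have hsvol : volume s = 2 := by
    rw [hs, Measure.volume_eq_prod, Measure.prod_prod, Real.volume_Icc, Real.volume_Ioo]
    norm_num
  have hP : ∫⁻ y, s.indicator 1 y ∂impulseMeasure ≤ ENNReal.ofReal ((2:ℝ) ^ 3) := by
    rw [lintegral_indicator_one hsm, ← setLIntegral_one, setLIntegral_impulseMeasure hsm]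
    calc _ ≤ ∫⁻ _ in s, 1 := by
          apply setLIntegral_mono' hsm
          intro x hx
          rw [mul_one, ENNReal.ofReal_le_one]
          exact hx.2.2.le
      _ = 2 := by simp [hsvol]
      _ ≤ _ := by norm_num
  have hle := hst.dblEnergy_le two_pos hP
  rw [pos_iff_ne_zero]
  intro h0
  rw [h0, mul_zero, nonpos_iff_eq_zero] at hle
  have hsμ : impulseMeasure s ≠ 0 := by
    intro hc
    have := volume_null_of_impulseMeasure_null (fun x hx => hx.2.1) hc
    rw [hsvol] at this
    norm_num at this
  unfold dblEnergy at hle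
  have hm := relPot_measurable hst.measurable
  have hm' := hst.measurable
  rw [lintegral_eq_zero_iff (by fun_prop)] at hle
  have hx : ∀ x ∈ s, relPot (s.indicator 1) x ≠ 0 := by
    intro x hx hc
    unfold relPot at hc
    rw [lintegral_eq_zero_iff (by fun_prop)] at hc
    apply hsμ
    rw [measure_eq_zero_iff_ae_notMem]
    filter_upwards [hc, ae_mem_H, ae_impulseMeasure_ne x] with y hy hyH hne hys
    have := greenKernel_pos (x := x) hx.2.1 hyH hne
    simp [hys] at hy
    exact this.ne' hy
  apply hsμ
  rw [measure_eq_zero_iff_ae_notMem]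
  filter_upwards [hle] with x h1 h2
  simp [h2] at h1
  exact hx x h2 h1

/-! ### Weak compactness of densities -/

lemma exists_subseq_tendsto_inner {E : Type*} [NormedAddCommGroup E] [InnerProductSpace ℝ E]
    [CompleteSpace E] [TopologicalSpace.SeparableSpace E] (x : ℕ → E) {r : ℝ}
    (hx : ∀ n, ‖x n‖ ≤ r) :
    ∃ v : E, ∃ φ : ℕ → ℕ, StrictMono φ ∧
      ∀ h : E, Tendsto (fun n => inner ℝ (x (φ n)) h) atTop (𝓝 (inner ℝ v h)) := by
  have hmem : ∀ n, StrongDual.toWeakDual (InnerProductSpace.toDual ℝ E (x n)) ∈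
      WeakDual.toStrongDual ⁻¹' Metric.closedBall (0 : StrongDual ℝ E) r := fun n => by
    simpa using hx n
  obtain ⟨l, -, φ, hφ, hl⟩ := WeakDual.isSeqCompact_closedBall ℝ E 0 r hmem
  refine ⟨(InnerProductSpace.toDual ℝ E).symm (WeakDual.toStrongDual l), φ, hφ, fun h => ?_⟩
  rw [InnerProductSpace.toDual_symm_apply]
  exact ((WeakDual.eval_continuous h).tendsto l).comp hl

lemma exists_weak_limit {X : Type*} [MeasurableSpace X] [MeasurableSpace.CountablyGenerated X]
    {μ : Measure X} [SigmaFinite μ] (ω : ℕ → X → ℝ≥0∞) (hm : ∀ n, Measurable (ω n))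
    (h1 : ∀ n x, ω n x ≤ 1) (hP : ∀ n, ∫⁻ x, ω n x ∂μ ≤ 1) :
    ∃ φ : ℕ → ℕ, StrictMono φ ∧ ∃ u : X → ℝ≥0∞, Measurable u ∧ (∀ x, u x ≤ 1) ∧
      ∀ g : X → ℝ≥0∞, Measurable g → ∫⁻ x, g x ^ 2 ∂μ ≠ ⊤ →
        Tendsto (fun n => ∫⁻ x, g x * ω (φ n) x ∂μ) atTop (𝓝 (∫⁻ x, g x * u x ∂μ)) := by
  have hfact : Fact ((2 : ℝ≥0∞) ≠ ⊤) := ⟨ENNReal.ofNat_ne_top⟩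
  have hfact1 : Fact ((1 : ℝ≥0∞) ≤ 2) := ⟨by norm_num⟩
  set w : ℕ → X → ℝ := fun n x => (ω n x).toReal with hw
  have hwm : ∀ n, Measurable (w n) := fun n => (hm n).ennreal_toReal
  have hw0 : ∀ n x, 0 ≤ w n x := fun n x => ENNReal.toReal_nonneg
  have hne : ∀ n x, ω n x ≠ ⊤ := fun n x => ne_top_of_le_ne_top ENNReal.one_ne_top (h1 n x)
  have hw1 : ∀ n x, w n x ≤ 1 := fun n x => by
    simpa using ENNReal.toReal_mono ENNReal.one_ne_top (h1 n x)
  have hnorm : ∀ n, eLpNorm (w n) 2 μ ≤ 1 := fun n => by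
    rw [eLpNorm_eq_lintegral_rpow_enorm_toReal two_ne_zero ENNReal.ofNat_ne_top]
    apply ENNReal.rpow_le_one _ (by norm_num)
    refine le_trans (lintegral_mono fun x => ?_) (hP n)
    have : ‖w n x‖ₑ = ω n x := by
      rw [Real.enorm_of_nonneg (hw0 n x), ENNReal.ofReal_toReal (hne n x)]
    rw [this]
    calc ω n x ^ (2 : ℝ≥0∞).toReal = ω n x * ω n x := by simp [sq]
      _ ≤ 1 * ω n x := by gcongr; exact h1 n x
      _ = ω n x := one_mul _
  have hmem : ∀ n, MemLp (w n) 2 μ := fun n =>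
    ⟨(hwm n).aestronglyMeasurable, (hnorm n).trans_lt ENNReal.one_lt_top⟩
  obtain ⟨v, φ, hφ, hv⟩ := exists_subseq_tendsto_inner (fun n => (hmem n).toLp) (r := 1)
    (fun n => by
      rw [Lp.norm_toLp]
      simpa using ENNReal.toReal_mono ENNReal.one_ne_top (hnorm n))
  have hconv : ∀ h : X → ℝ, MemLp h 2 μ →
      Tendsto (fun n => ∫ x, h x * w (φ n) x ∂μ) atTop (𝓝 (∫ x, h x * v x ∂μ)) := by
    intro h hh
    convert hv hh.toLp using 1
    · ext n
      rw [L2.inner_def]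
      apply integral_congr_ae
      filter_upwards [hh.coeFn_toLp, (hmem (φ n)).coeFn_toLp] with x h1 h2
      simp [h1, h2]
    · congr 1
      refine Eq.trans (integral_congr_ae ?_) (L2.inner_def (𝕜 := ℝ) v hh.toLp).symm
      filter_upwards [hh.coeFn_toLp] with x h1
      simp [h1]
  have hvmem : MemLp v 2 μ := Lp.memLp v
  have hvint : ∀ s, MeasurableSet s → μ s < ⊤ → IntegrableOn v s μ := fun s hs hμ => by
    have : IsFiniteMeasure (μ.restrict s) := ⟨by simpa using hμ⟩
    exact (hvmem.restrict s).integrable hfact1.out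
  have hset : ∀ s, MeasurableSet s → μ s < ⊤ →
      Tendsto (fun n => ∫ x in s, w (φ n) x ∂μ) atTop (𝓝 (∫ x in s, v x ∂μ)) := by
    intro s hs hμ
    have h := hconv (s.indicator fun _ => 1) (memLp_indicator_const 2 hs 1 (Or.inr hμ.ne))
    have key : ∀ f : X → ℝ, ∫ x, s.indicator (fun _ => (1:ℝ)) x * f x ∂μ = ∫ x in s, f x ∂μ := by
      intro f
      rw [← integral_indicator hs]
      congr 1 with x
      by_cases hx : x ∈ s <;> simp [hx]
    simpa only [key] using h
  have hwint : ∀ n s, MeasurableSet s → μ s < ⊤ → IntegrableOn (w n) s μ := fun n s hs hμ => by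
    have : IsFiniteMeasure (μ.restrict s) := ⟨by simpa using hμ⟩
    exact ((hmem n).restrict s).integrable hfact1.out
  have hv0 : 0 ≤ᵐ[μ] v := by
    refine ae_nonneg_of_forall_setIntegral_nonneg_of_sigmaFinite hvint fun s hs hμ => ?_
    exact ge_of_tendsto' (hset s hs hμ) fun n => integral_nonneg fun x => hw0 _ x
  have hv1 : 0 ≤ᵐ[μ] fun x => 1 - v x := by
    have hc : ∀ s, μ s < ⊤ → IntegrableOn (fun _ => (1:ℝ)) s μ := fun s hμ =>
      integrableOn_const hμ.ne
    refine ae_nonneg_of_forall_setIntegral_nonneg_of_sigmaFinite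
      (fun s hs hμ => (hc s hμ).sub (hvint s hs hμ)) fun s hs hμ => ?_
    rw [integral_sub (hc s hμ) (hvint s hs hμ), sub_nonneg]
    exact le_of_tendsto' (hset s hs hμ) fun n =>
      setIntegral_mono (hwint _ s hs hμ) (hc s hμ) fun x => hw1 _ x
  obtain ⟨v', hv'm, hvv'⟩ := (Lp.aestronglyMeasurable v).aemeasurable
  refine ⟨φ, hφ, fun x => min (ENNReal.ofReal (v' x)) 1, by fun_prop, fun x => min_le_right _ _,
    fun g hg hg2 => ?_⟩
  have hgtop : ∀ᵐ x ∂μ, g x < ⊤ := by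
    filter_upwards [ae_lt_top (by fun_prop) hg2] with x hx
    contrapose! hx
    simp [top_le_iff.1 hx]
  have hgmem : MemLp (fun x => (g x).toReal) 2 μ := by
    refine ⟨hg.ennreal_toReal.aestronglyMeasurable, ?_⟩
    rw [eLpNorm_lt_top_iff_lintegral_rpow_enorm_lt_top two_ne_zero ENNReal.ofNat_ne_top]
    refine lt_of_le_of_lt (lintegral_mono fun x => ?_) hg2.lt_top
    have : ‖(g x).toReal‖ₑ ≤ g x := by
      rw [Real.enorm_of_nonneg ENNReal.toReal_nonneg]
      exact ENNReal.ofReal_toReal_le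
    calc ‖(g x).toReal‖ₑ ^ (2 : ℝ≥0∞).toReal = ‖(g x).toReal‖ₑ ^ 2 := by simp
      _ ≤ g x ^ 2 := by gcongr
  have hl : ∀ n, ∫⁻ x, g x * ω n x ∂μ = ENNReal.ofReal (∫ x, (g x).toReal * w n x ∂μ) := by
    intro n
    rw [ofReal_integral_eq_lintegral_ofReal (f := fun x => (g x).toReal * w n x)
      (hgmem.integrable_mul (hmem n))
      (Eventually.of_forall fun x => mul_nonneg ENNReal.toReal_nonneg (hw0 n x))]
    apply lintegral_congr_ae
    filter_upwards [hgtop] with x hx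
    rw [ENNReal.ofReal_mul ENNReal.toReal_nonneg, ENNReal.ofReal_toReal hx.ne,
      ENNReal.ofReal_toReal (hne n x)]
  have hr : ∫⁻ x, g x * min (ENNReal.ofReal (v' x)) 1 ∂μ =
      ENNReal.ofReal (∫ x, (g x).toReal * v x ∂μ) := by
    rw [ofReal_integral_eq_lintegral_ofReal (f := fun x => (g x).toReal * v x)
      (hgmem.integrable_mul hvmem)
      (by filter_upwards [hv0] with x hx using mul_nonneg ENNReal.toReal_nonneg hx)]
    apply lintegral_congr_ae
    filter_upwards [hgtop, hv1, hvv'] with x hx h1 h2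
    rw [ENNReal.ofReal_mul ENNReal.toReal_nonneg, ENNReal.ofReal_toReal hx.ne, h2,
      min_eq_left]
    rw [← h2]
    exact ENNReal.ofReal_le_one.2 (by simpa using h1)
  simp only [hl, hr]
  exact (ENNReal.continuous_ofReal.tendsto _).comp (hconv _ hgmem)

/-- Convergence of densities tested against square integrable functions. -/
def WeakLim (ω : ℕ → ℝ × ℝ → ℝ≥0∞) (u : ℝ × ℝ → ℝ≥0∞) : Prop :=
  ∀ g : ℝ × ℝ → ℝ≥0∞, Measurable g → ∫⁻ x, g x ^ 2 ∂impulseMeasure ≠ ⊤ →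
    Tendsto (fun n => ∫⁻ x, g x * ω n x ∂impulseMeasure) atTop
      (𝓝 (∫⁻ x, g x * u x ∂impulseMeasure))

lemma WeakLim.tendsto_setLIntegral {ω : ℕ → ℝ × ℝ → ℝ≥0∞} {u : ℝ × ℝ → ℝ≥0∞} (h : WeakLim ω u)
    {s : Set (ℝ × ℝ)} (hs : MeasurableSet s) (hμ : impulseMeasure s ≠ ⊤) :
    Tendsto (fun n => ∫⁻ x in s, ω n x ∂impulseMeasure) atTop
      (𝓝 (∫⁻ x in s, u x ∂impulseMeasure)) := by
  have key : ∀ f : ℝ × ℝ → ℝ≥0∞, ∫⁻ x, s.indicator (fun _ => 1) x * f x ∂impulseMeasure =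
      ∫⁻ x in s, f x ∂impulseMeasure := fun f => by
    rw [← lintegral_indicator hs]
    congr 1 with x
    by_cases hx : x ∈ s <;> simp [hx]
  have := h (s.indicator fun _ => 1) (measurable_const.indicator hs) (by
    have h2 : ∀ x, s.indicator (fun _ => (1 : ℝ≥0∞)) x ^ 2 = s.indicator (fun _ => 1) x := fun x => by
      by_cases hx : x ∈ s <;> simp [hx]
    simpa only [h2, lintegral_indicator_const hs, one_mul] using hμ)
  simpa only [key] using this

lemma WeakLim.lintegral_le {ω : ℕ → ℝ × ℝ → ℝ≥0∞} {u : ℝ × ℝ → ℝ≥0∞} (h : WeakLim ω u)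
    (hP : ∀ n, ∫⁻ x, ω n x ∂impulseMeasure ≤ 1) :
    ∫⁻ x, u x ∂impulseMeasure ≤ 1 := by
  refine lintegral_le_of_forall_fin_meas_le 1 fun s hs hμ => ?_
  exact le_of_tendsto' (h.tendsto_setLIntegral hs hμ) fun n =>
    (setLIntegral_le_lintegral _ _).trans (hP n)

lemma WeakLim.aeSteiner {ω : ℕ → ℝ × ℝ → ℝ≥0∞} {u : ℝ × ℝ → ℝ≥0∞} (h : WeakLim ω u)
    (hu : Measurable u) (hω : ∀ n, Measurable (ω n)) (hS : ∀ n, AESteiner (ω n)) :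
    AESteiner u := by
  intro m
  set S : Set (ℝ × ℝ) := {y | |y.1| ≤ |2 * m - y.1|} with hSdef
  have hSm : MeasurableSet S := measurableSet_le (by fun_prop) (by fun_prop)
  have hR := measurePreserving_vertRefl m
  have key : ∀ f : ℝ × ℝ → ℝ≥0∞, Measurable f → ∀ s, MeasurableSet s →
      ∫⁻ x in s, S.indicator (fun x => f (vertRefl m x)) x ∂impulseMeasure =
        ∫⁻ x in vertRefl m ⁻¹' (s ∩ S), f x ∂impulseMeasure := by
    intro f hf s hs
    rw [setLIntegral_indicator hSm, inter_comm,
      ← hR.setLIntegral_comp_preimage (hs.inter hSm) (f := fun x => f (vertRefl m x)) (by fun_prop)]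
    simp
  have hle : S.indicator (fun x => u (vertRefl m x)) ≤ᵐ[impulseMeasure] S.indicator u := by
    refine ae_le_of_forall_setLIntegral_le_of_sigmaFinite
      (Measurable.indicator (by fun_prop) hSm) fun s hs hμ => ?_
    have hsS : impulseMeasure (s ∩ S) ≠ ⊤ := measure_ne_top_of_subset inter_subset_left hμ.ne
    rw [key u hu s hs, setLIntegral_indicator hSm, inter_comm S]
    refine le_of_tendsto_of_tendsto' (h.tendsto_setLIntegral (hR.measurable (hs.inter hSm)) ?_)
      (h.tendsto_setLIntegral (hs.inter hSm) hsS) fun n => ?_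
    · rwa [hR.measure_preimage (hs.inter hSm).nullMeasurableSet]
    · rw [← key _ (hω n) s hs, setLIntegral_indicator hSm, inter_comm S]
      refine lintegral_mono_ae ?_
      filter_upwards [ae_restrict_mem (hs.inter hSm), ae_restrict_of_ae (hS n m)] with y hy hle
      exact hle hy.2
  filter_upwards [hle] with y hy hyS
  simpa [indicator_of_mem (show y ∈ S from hyS)] using hy

lemma lintegral_far_kernel_sq_ne_top {x : ℝ × ℝ} (hx : x ∈ H) {r : ℝ} (hr : 0 < r) :
    ∫⁻ y, {y : ℝ × ℝ | r ≤ ‖x - y‖}.indicator (greenKernel x) y ^ 2 ∂impulseMeasure ≠ ⊤ := by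
  set s := {y : ℝ × ℝ | r ≤ ‖x - y‖} with hs
  have hsm : MeasurableSet s := measurableSet_le (by fun_prop) (by fun_prop)
  refine (lt_of_le_of_lt ?_ (lintegral_inv_norm_cube_lt_top x hr)).ne
  have h2 : ∀ y, s.indicator (greenKernel x) y ^ 2 = s.indicator (fun y => greenKernel x y ^ 2) y :=
    fun y => by by_cases hy : y ∈ s <;> simp [hy]
  simp only [h2]
  rw [lintegral_indicator hsm, setLIntegral_impulseMeasure hsm]
  apply lintegral_mono_ae
  have hne : ∀ᵐ y : ℝ × ℝ, y ≠ x := by simp [ae_iff]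
  filter_upwards [ae_restrict_mem hsm, ae_restrict_of_ae hne] with y hy hyx
  have hy' : 0 < ‖x - y‖ := hr.trans_le hy
  rcases le_or_gt y.2 0 with h | h
  · simp [ENNReal.ofReal_of_nonpos h]
  · calc ENNReal.ofReal y.2 * greenKernel x y ^ 2
        = (ENNReal.ofReal y.2 * greenKernel x y) * greenKernel x y := by ring
      _ ≤ ENNReal.ofReal (1 / ‖x - y‖) * ENNReal.ofReal (1 / ‖x - y‖ ^ 2) := by
          gcongr
          · exact mul_greenKernel_le_inv hx h hyx
          · exact greenKernel_le_inv_sq hx h hyx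
      _ = _ := by
          rw [← ENNReal.ofReal_mul (by positivity)]
          congr 1
          field_simp

lemma WeakLim.tendsto_relPot {ω : ℕ → ℝ × ℝ → ℝ≥0∞} {u : ℝ × ℝ → ℝ≥0∞} (h : WeakLim ω u)
    (hu : Measurable u) (hu1 : ∀ y, u y ≤ 1)
    (h1 : ∀ n y, ω n y ≤ 1) (hP : ∀ n, ∫⁻ x, ω n x ∂impulseMeasure ≤ 1)
    {x : ℝ × ℝ} (hx : x ∈ H) :
    Tendsto (fun n => relPot (ω n) x) atTop (𝓝 (relPot u x)) := by
  have hL : relPot u x ≠ ⊤ :=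
    ne_top_of_le_ne_top (by norm_num) (relPot_le_nine hu hu1 hx (h.lintegral_le hP))
  rw [ENNReal.tendsto_nhds hL]
  intro ε hε
  set e := min ε 1 with he
  have he0 : 0 < e := lt_min hε one_pos
  have het : e ≠ ⊤ := ne_top_of_le_ne_top ENNReal.one_ne_top (min_le_right _ _)
  set r := e.toReal / 16 with hr_def
  have hr : 0 < r := by have := ENNReal.toReal_pos he0.ne' het; positivity
  have h8r : ENNReal.ofReal (8 * r) = e / 2 := by
    rw [hr_def, show 8 * (e.toReal / 16) = e.toReal / 2 by ring,
      ENNReal.ofReal_div_of_pos (by norm_num), ENNReal.ofReal_toReal het]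
    norm_num
  set s := {y : ℝ × ℝ | r ≤ ‖x - y‖} with hs
  have hsm : MeasurableSet s := measurableSet_le (by fun_prop) (by fun_prop)
  have key : ∀ f : ℝ × ℝ → ℝ≥0∞, ∫⁻ y, s.indicator (greenKernel x) y * f y ∂impulseMeasure =
      ∫⁻ y in s, greenKernel x y * f y ∂impulseMeasure := fun f => by
    rw [← lintegral_indicator hsm]
    congr 1 with y
    by_cases hy : y ∈ s <;> simp [hy]
  have hF := h (s.indicator (greenKernel x)) (Measurable.indicator (by fun_prop) hsm)
    (lintegral_far_kernel_sq_ne_top hx hr)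
  simp only [key] at hF
  have hFt : ∫⁻ y in s, greenKernel x y * u y ∂impulseMeasure ≠ ⊤ :=
    ne_top_of_le_ne_top hL (setLIntegral_le_lintegral _ _)
  have he2 : 0 < e / 2 := ENNReal.half_pos he0.ne'
  filter_upwards [(ENNReal.tendsto_nhds hFt).1 hF (e / 2) he2] with n hn
  have hsum : e / 2 + e / 2 ≤ ε := by rw [ENNReal.add_halves]; exact min_le_left _ _
  rw [relPot_split (ω n) x r, relPot_split u x r]
  have hN := setLIntegral_near_le (h1 n) hx hr
  have hN' := setLIntegral_near_le hu1 hx hr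
  rw [h8r] at hN hN'
  obtain ⟨hn1, hn2⟩ := hn
  rw [tsub_le_iff_right] at hn1
  constructor
  · rw [tsub_le_iff_right]
    calc _ ≤ e / 2 + (∫⁻ y in s, greenKernel x y * ω n y ∂impulseMeasure + e / 2) := by gcongr
      _ = 0 + ∫⁻ y in s, greenKernel x y * ω n y ∂impulseMeasure + (e / 2 + e / 2) := by ring
      _ ≤ _ := by gcongr; exact zero_le
  · calc _ ≤ e / 2 + (∫⁻ y in s, greenKernel x y * u y ∂impulseMeasure + e / 2) := by gcongr
      _ = 0 + ∫⁻ y in s, greenKernel x y * u y ∂impulseMeasure + (e / 2 + e / 2) := by ring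
      _ ≤ _ := by gcongr; exact zero_le

/-! ### The maximization problem -/

lemma exists_maximizing_seq : ∃ ω : ℕ → ℝ × ℝ → ℝ≥0∞, (∀ n, IsSteiner (ω n)) ∧
    (∀ n, ∫⁻ y, ω n y ∂impulseMeasure ≤ 1) ∧
    Tendsto (fun n => dblEnergy (ω n)) atTop (𝓝 maxDblEnergy) ∧
    ∃ u : ℝ × ℝ → ℝ≥0∞, Measurable u ∧ (∀ y, u y ≤ 1) ∧ WeakLim ω u := by
  have : Nonempty {ω : ℝ × ℝ → ℝ≥0∞ // IsSteiner ω ∧ ∫⁻ y, ω y ∂impulseMeasure ≤ 1} :=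
    ⟨0, ⟨measurable_zero, by simp, by simp⟩, by simp⟩
  obtain ⟨v, -, hv⟩ := exists_seq_tendsto_sSup
    (range_nonempty fun ω : {ω : ℝ × ℝ → ℝ≥0∞ // IsSteiner ω ∧ ∫⁻ y, ω y ∂impulseMeasure ≤ 1} =>
      dblEnergy ω) (OrderTop.bddAbove _)
  obtain ⟨hv1, hv2⟩ := hv
  choose ω hω using hv2
  obtain ⟨φ, hφ, u, hu, hu1, hlim⟩ := exists_weak_limit (μ := impulseMeasure)
    (fun n => (ω n : ℝ × ℝ → ℝ≥0∞)) (fun n => (ω n).2.1.measurable)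
    (fun n => (ω n).2.1.le_one) (fun n => (ω n).2.2)
  refine ⟨fun n => ω (φ n), fun n => (ω _).2.1, fun n => (ω _).2.2, ?_, u, hu, hu1, hlim⟩
  have : Tendsto v atTop (𝓝 maxDblEnergy) := hv1
  refine (this.comp hφ.tendsto_atTop).congr fun n => ?_
  exact (hω _).symm

/-- The rectangle `|x₁| < A`, `0 < x₂ < A`. -/
def box (A : ℝ) : Set (ℝ × ℝ) := Ioo (-A) A ×ˢ Ioo 0 A

lemma measurableSet_box (A : ℝ) : MeasurableSet (box A) := measurableSet_Ioo.prod measurableSet_Ioo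

lemma impulseMeasure_box_ne_top (A : ℝ) : impulseMeasure (box A) ≠ ⊤ := by
  rw [← setLIntegral_one, setLIntegral_impulseMeasure (measurableSet_box A)]
  have h : ∫⁻ x in box A, ENNReal.ofReal x.2 * 1 ≤ ∫⁻ _ in box A, ENNReal.ofReal A := by
    apply setLIntegral_mono' (measurableSet_box A)
    intro x hx
    rw [mul_one]
    exact ENNReal.ofReal_le_ofReal hx.2.2.le
  refine ne_top_of_le_ne_top ?_ h
  rw [setLIntegral_const]
  refine ENNReal.mul_ne_top ENNReal.ofReal_ne_top ?_
  rw [box, Measure.volume_eq_prod, Measure.prod_prod, Real.volume_Ioo, Real.volume_Ioo]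
  exact ENNReal.mul_ne_top ENNReal.ofReal_ne_top ENNReal.ofReal_ne_top

lemma box_subset_H (A : ℝ) : box A ⊆ H := fun _ hx => hx.2.1

lemma notMem_box {A : ℝ} {x : ℝ × ℝ} (hx : x ∈ H) (h : x ∉ box A) : A ≤ |x.1| ∨ A ≤ x.2 := by
  by_contra! hc
  exact h ⟨abs_lt.1 hc.1, hx, hc.2⟩

lemma le_lintegral_of_weakLim {ω : ℕ → ℝ × ℝ → ℝ≥0∞} {u : ℝ × ℝ → ℝ≥0∞} {C : ℝ≥0∞}
    (hω : ∀ n, IsSteiner (ω n)) (hP : ∀ n, ∫⁻ y, ω n y ∂impulseMeasure ≤ 1)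
    (hC : Tendsto (fun n => dblEnergy (ω n)) atTop (𝓝 C)) (hu : Measurable u)
    (hu1 : ∀ y, u y ≤ 1) (hlim : WeakLim ω u) : C ≤ dblEnergy u := by
  refine ENNReal.le_of_forall_pos_le_add fun ε hε _ => ?_
  obtain ⟨A, hA, htail⟩ := exists_relPot_tail (ε := ε) hε
  set Q := box A
  have hQm : MeasurableSet Q := measurableSet_box A
  set f := relPot u with hf
  have hfm : Measurable f := relPot_measurable hu
  have hf9 : ∀ x ∈ H, f x ≤ 9 := fun x hx => relPot_le_nine hu hu1 hx (hlim.lintegral_le hP)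
  have hfn9 : ∀ n, ∀ x ∈ H, relPot (ω n) x ≤ 9 := fun n x hx =>
    relPot_le_nine (hω n).measurable (hω n).le_one hx (hP n)
  have hfnm : ∀ n, Measurable (relPot (ω n)) := fun n => relPot_measurable (hω n).measurable
  have hωm : ∀ n, Measurable (ω n) := fun n => (hω n).measurable
  have hbound : ∀ n, dblEnergy (ω n) ≤ ∫⁻ x, Q.indicator f x * ω n x ∂impulseMeasure +
      ∫⁻ x in Q, (relPot (ω n) x - f x) ∂impulseMeasure + ε := by
    intro n
    calc dblEnergy (ω n) ≤ ∫⁻ x, (Q.indicator f x * ω n x +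
          Q.indicator (fun x => relPot (ω n) x - f x) x + ε * ω n x) ∂impulseMeasure := by
          apply lintegral_mono_ae
          filter_upwards [ae_mem_H] with x hx
          by_cases hxQ : x ∈ Q
          · simp only [indicator_of_mem hxQ]
            refine le_trans ?_ le_self_add
            calc relPot (ω n) x * ω n x ≤ (f x + (relPot (ω n) x - f x)) * ω n x := by
                  gcongr; exact le_add_tsub
              _ = f x * ω n x + (relPot (ω n) x - f x) * ω n x := by ring
              _ ≤ f x * ω n x + (relPot (ω n) x - f x) * 1 := by
                  gcongr; exact (hω n).le_one x
              _ = _ := by rw [mul_one]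
          · refine le_trans ?_ le_add_self
            gcongr
            have := htail _ (hω n) (hP n) x hx (notMem_box hx hxQ)
            simpa using this
      _ = ∫⁻ x, Q.indicator f x * ω n x ∂impulseMeasure +
          ∫⁻ x in Q, (relPot (ω n) x - f x) ∂impulseMeasure +
            ε * ∫⁻ x, ω n x ∂impulseMeasure := by
          rw [lintegral_add_right _ (by fun_prop), lintegral_const_mul _ (hωm n),
            lintegral_add_left (f := fun x => Q.indicator f x * ω n x)
              ((hfm.indicator hQm).mul (hωm n)), lintegral_indicator hQm]
      _ ≤ _ := by
          gcongr
          exact mul_le_of_le_one_right zero_le (hP n)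
  have h1 : Tendsto (fun n => ∫⁻ x, Q.indicator f x * ω n x ∂impulseMeasure) atTop
      (𝓝 (∫⁻ x, Q.indicator f x * u x ∂impulseMeasure)) := by
    refine hlim _ (hfm.indicator hQm) ?_
    have : ∫⁻ x, Q.indicator f x ^ 2 ∂impulseMeasure ≤ ∫⁻ _ in Q, 9 ^ 2 ∂impulseMeasure := by
      rw [← lintegral_indicator hQm]
      apply lintegral_mono
      intro x
      by_cases hx : x ∈ Q
      · simp only [indicator_of_mem hx]
        gcongr
        exact hf9 x (box_subset_H A hx)
      · simp [hx]
    refine ne_top_of_le_ne_top ?_ this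
    rw [setLIntegral_const]
    exact ENNReal.mul_ne_top (by norm_num) (impulseMeasure_box_ne_top A)
  have h2 : Tendsto (fun n => ∫⁻ x in Q, (relPot (ω n) x - f x) ∂impulseMeasure) atTop
      (𝓝 (∫⁻ _ in Q, 0 ∂impulseMeasure)) := by
    refine tendsto_lintegral_of_dominated_convergence (fun _ => 9) (fun n => by fun_prop) ?_ ?_ ?_
    · intro n
      filter_upwards [ae_restrict_mem hQm] with x hx
      exact tsub_le_self.trans (hfn9 n x (box_subset_H A hx))
    · rw [setLIntegral_const]
      exact ENNReal.mul_ne_top (by norm_num) (impulseMeasure_box_ne_top A)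
    · filter_upwards [ae_restrict_mem hQm] with x hx
      have hxH := box_subset_H A hx
      have hft : f x ≠ ⊤ := ne_top_of_le_ne_top (by norm_num) (hf9 x hxH)
      have := ENNReal.Tendsto.sub (hlim.tendsto_relPot hu hu1 (fun n => (hω n).le_one) hP hxH)
        (tendsto_const_nhds (x := f x)) (Or.inr hft)
      rwa [← hf, tsub_self] at this
  have h3 := le_of_tendsto_of_tendsto' hC ((h1.add h2).add tendsto_const_nhds) hbound
  refine h3.trans ?_
  rw [lintegral_zero, add_zero]
  gcongr
  apply lintegral_mono
  intro x
  dsimp only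
  gcongr
  exact indicator_le_self' (by simp) x

lemma lintegral_relPot_mul_comm {u v : ℝ × ℝ → ℝ≥0∞} (hu : Measurable u) (hv : Measurable v) :
    ∫⁻ x, relPot u x * v x ∂impulseMeasure = ∫⁻ x, relPot v x * u x ∂impulseMeasure := by
  have h : ∀ u v : ℝ × ℝ → ℝ≥0∞, Measurable u → Measurable v →
      ∫⁻ x, relPot u x * v x ∂impulseMeasure =
      ∫⁻ x, ∫⁻ y, greenKernel x y * u y * v x ∂impulseMeasure ∂impulseMeasure := by
    intro u v hu hv
    unfold relPot
    congr 1 with x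
    rw [lintegral_mul_const _ (by fun_prop)]
  rw [h u v hu hv, h v u hv hu, lintegral_lintegral_swap (by fun_prop)]
  congr 1 with x
  congr 1 with y
  rw [greenKernel_comm]
  ring

lemma relPot_add_mul {u v : ℝ × ℝ → ℝ≥0∞} (hu : Measurable u) (hv : Measurable v) (a b : ℝ≥0∞)
    (x : ℝ × ℝ) : relPot (fun y => a * u y + b * v y) x = a * relPot u x + b * relPot v x := by
  unfold relPot
  rw [← lintegral_const_mul _ (by fun_prop), ← lintegral_const_mul _ (by fun_prop),
    ← lintegral_add_left (by fun_prop)]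
  congr 1 with y
  ring

lemma dblEnergy_add_mul_ge {u v : ℝ × ℝ → ℝ≥0∞} (hu : Measurable u) (hv : Measurable v)
    (a b : ℝ≥0∞) :
    a ^ 2 * dblEnergy u + 2 * a * b * ∫⁻ x, relPot u x * v x ∂impulseMeasure ≤
      dblEnergy fun y => a * u y + b * v y := by
  have hpu := relPot_measurable hu
  have hpv := relPot_measurable hv
  calc a ^ 2 * dblEnergy u + 2 * a * b * ∫⁻ x, relPot u x * v x ∂impulseMeasure
      = a ^ 2 * dblEnergy u + (a * b * ∫⁻ x, relPot u x * v x ∂impulseMeasure +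
          a * b * ∫⁻ x, relPot v x * u x ∂impulseMeasure) := by
        rw [lintegral_relPot_mul_comm hv hu]; ring
    _ = ∫⁻ x, (a ^ 2 * (relPot u x * u x) + (a * b * (relPot u x * v x) +
          a * b * (relPot v x * u x))) ∂impulseMeasure := by
        unfold dblEnergy
        rw [← lintegral_const_mul _ (by fun_prop), ← lintegral_const_mul _ (by fun_prop),
          ← lintegral_const_mul _ (by fun_prop), ← lintegral_add_left (by fun_prop),
          ← lintegral_add_left (by fun_prop)]
    _ ≤ _ := by
        unfold dblEnergy
        apply lintegral_mono
        intro x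
        simp only [relPot_add_mul hu hv]
        calc _ ≤ a ^ 2 * (relPot u x * u x) + (a * b * (relPot u x * v x) +
          a * b * (relPot v x * u x)) + b ^ 2 * (relPot v x * v x) := le_self_add
          _ = _ := by ring

lemma IsSteiner.add_mul {u v : ℝ × ℝ → ℝ≥0∞} (hu : IsSteiner u) (hv : IsSteiner v) {a b : ℝ≥0∞}
    (hab : a + b = 1) : IsSteiner fun y => a * u y + b * v y where
  measurable := by
    have := hu.measurable
    have := hv.measurable
    fun_prop
  le_one x := by
    calc a * u x + b * v x ≤ a * 1 + b * 1 := by gcongr; exacts [hu.le_one x, hv.le_one x]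
      _ = 1 := by simpa using hab
  anti a' b' t h := by
    gcongr
    exacts [hu.anti _ _ _ h, hv.anti _ _ _ h]

/-- The travelling speed of the patch, `W = (4/3) E`. -/
def patchSpeed : ℝ := 2 / 3 * maxDblEnergy.toReal

lemma maxDblEnergy_ne_top : maxDblEnergy ≠ ⊤ :=
  ne_top_of_le_ne_top (by norm_num) maxDblEnergy_le

lemma patchSpeed_pos : 0 < patchSpeed := by
  have := ENNReal.toReal_pos maxDblEnergy_pos.ne' maxDblEnergy_ne_top
  unfold patchSpeed
  positivity

lemma le_of_perturbation {C J q : ℝ}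
    (h : ∀ t : ℝ, 0 < t → t < 1 →
      (1 - t) ^ 2 * C + 2 * (1 - t) * t * J ≤ (1 + t * q) ^ 4 * C) :
    J ≤ (1 + 2 * q) * C := by
  have hl : Tendsto (fun t : ℝ => (1 - t) * J) (𝓝[>] 0) (𝓝 ((1 - 0) * J)) :=
    (Continuous.tendsto (by fun_prop) 0).mono_left nhdsWithin_le_nhds
  have hr : Tendsto (fun t : ℝ => (1 + 2 * q + t * (6 * q ^ 2 + 4 * t * q ^ 3 + t ^ 2 * q ^ 4 - 1)
      / 2) * C) (𝓝[>] 0)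
      (𝓝 ((1 + 2 * q + 0 * (6 * q ^ 2 + 4 * 0 * q ^ 3 + 0 ^ 2 * q ^ 4 - 1) / 2) * C)) :=
    (Continuous.tendsto (f := fun t : ℝ => (1 + 2 * q + t * (6 * q ^ 2 + 4 * t * q ^ 3 +
      t ^ 2 * q ^ 4 - 1) / 2) * C) (by fun_prop) 0).mono_left nhdsWithin_le_nhds
  have := le_of_tendsto_of_tendsto hl hr (by
    filter_upwards [Ioo_mem_nhdsGT (show (0:ℝ) < 1 by norm_num)] with t ht
    have h1 := h t ht.1 ht.2
    have ht0 := ht.1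
    refine le_of_mul_le_mul_left ?_ (show 0 < 2 * t by positivity)
    linarith)
  simpa using this

/-- First order optimality along a maximizing sequence. -/
lemma variation_le {ω : ℕ → ℝ × ℝ → ℝ≥0∞} {u η : ℝ × ℝ → ℝ≥0∞}
    (hω : ∀ n, IsSteiner (ω n)) (hP : ∀ n, ∫⁻ y, ω n y ∂impulseMeasure ≤ 1)
    (hC : Tendsto (fun n => dblEnergy (ω n)) atTop (𝓝 maxDblEnergy)) (hu : Measurable u)
    (hu1 : ∀ y, u y ≤ 1) (hlim : WeakLim ω u) (hη : IsSteiner η)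
    (hηP : ∫⁻ y, η y ∂impulseMeasure ≠ ⊤) :
    (∫⁻ x, relPot u x * η x ∂impulseMeasure).toReal ≤
      maxDblEnergy.toReal / 3 + patchSpeed * (∫⁻ y, η y ∂impulseMeasure).toReal := by
  set p := (∫⁻ y, η y ∂impulseMeasure).toReal with hp
  have hp0 : 0 ≤ p := ENNReal.toReal_nonneg
  have hηm := hη.measurable
  set J := ∫⁻ x, relPot u x * η x ∂impulseMeasure with hJ
  have hJlim : Tendsto (fun n => ∫⁻ x, relPot (ω n) x * η x ∂impulseMeasure) atTop (𝓝 J) := by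
    refine tendsto_lintegral_of_dominated_convergence (fun x => 9 * η x)
      (fun n => (relPot_measurable (hω n).measurable).mul hηm) ?_ ?_ ?_
    · intro n
      filter_upwards [ae_mem_H] with x hx
      gcongr
      exact relPot_le_nine (hω n).measurable (hω n).le_one hx (hP n)
    · rw [lintegral_const_mul _ hηm]
      exact ENNReal.mul_ne_top (by norm_num) hηP
    · filter_upwards [ae_mem_H] with x hx
      refine ENNReal.Tendsto.mul_const
        (hlim.tendsto_relPot hu hu1 (fun n => (hω n).le_one) hP hx) (Or.inr ?_)
      exact ne_top_of_le_ne_top ENNReal.one_ne_top (hη.le_one x)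
  have hJtop : J ≠ ⊤ := by
    have : J ≤ ∫⁻ x, 9 * η x ∂impulseMeasure := by
      apply lintegral_mono_ae
      filter_upwards [ae_mem_H] with x hx
      gcongr
      exact relPot_le_nine hu hu1 hx (hlim.lintegral_le hP)
    refine ne_top_of_le_ne_top ?_ this
    rw [lintegral_const_mul _ hηm]
    exact ENNReal.mul_ne_top (by norm_num) hηP
  have key : ∀ t : ℝ, 0 < t → t < 1 → (1 - t) ^ 2 * maxDblEnergy.toReal +
      2 * (1 - t) * t * J.toReal ≤ (1 + t * ((p - 1) / 3)) ^ 4 * maxDblEnergy.toReal := by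
    intro t ht0 ht1
    have h1t : 0 < 1 - t := by linarith
    set a := ENNReal.ofReal (1 - t) with ha
    set b := ENNReal.ofReal t with hb
    have hab : a + b = 1 := by
      rw [ha, hb, ← ENNReal.ofReal_add h1t.le ht0.le]
      simp
    set s := 1 + t * ((p - 1) / 3) with hs
    have hs0 : 0 < s := by nlinarith
    have hmix : ∀ n, a ^ 2 * dblEnergy (ω n) + 2 * a * b *
        ∫⁻ x, relPot (ω n) x * η x ∂impulseMeasure ≤ ENNReal.ofReal (s ^ 4) * maxDblEnergy := by
      intro n
      refine (dblEnergy_add_mul_ge (hω n).measurable hηm a b).trans ?_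
      refine ((hω n).add_mul hη hab).dblEnergy_le hs0 ?_
      have := (hω n).measurable
      rw [lintegral_add_left (by fun_prop), lintegral_const_mul _ (by fun_prop),
        lintegral_const_mul _ (by fun_prop)]
      calc _ ≤ a * 1 + b * ENNReal.ofReal p := by
            gcongr
            · exact hP n
            · rw [hp, ENNReal.ofReal_toReal hηP]
        _ = ENNReal.ofReal (1 + t * (p - 1)) := by
            rw [mul_one, ha, hb, ← ENNReal.ofReal_mul ht0.le,
              ← ENNReal.ofReal_add h1t.le (by positivity)]
            congr 1
            ring
        _ ≤ _ := by
            apply ENNReal.ofReal_le_ofReal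
            have := one_add_mul_le_pow (a := t * ((p - 1) / 3)) (by nlinarith) 3
            push_cast at this
            rw [hs]
            linarith
    have hl : Tendsto (fun n => a ^ 2 * dblEnergy (ω n) + 2 * a * b *
        ∫⁻ x, relPot (ω n) x * η x ∂impulseMeasure) atTop
        (𝓝 (a ^ 2 * maxDblEnergy + 2 * a * b * J)) := by
      refine (ENNReal.Tendsto.const_mul hC (Or.inr (by finiteness))).add
        (ENNReal.Tendsto.const_mul hJlim (Or.inr (by finiteness)))
    have h := le_of_tendsto' hl hmix
    have h2 := ENNReal.toReal_mono (ENNReal.mul_ne_top ENNReal.ofReal_ne_top maxDblEnergy_ne_top) h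
    have hCt := maxDblEnergy_ne_top
    rw [ENNReal.toReal_add (by finiteness) (by finiteness)] at h2
    simpa [ha, hb, ENNReal.toReal_ofReal, h1t.le, ht0.le, hs0.le] using h2
  have := le_of_perturbation key
  unfold patchSpeed
  linarith

lemma mul_add_mul_le_of_indicator {f u W e : ℝ≥0∞} (hu : u ≤ 1)
    (h1 : W < f → e = 1) (h0 : f ≤ W → e = 0) : f * u + W * e ≤ f * e + W * u := by
  rcases lt_or_ge W f with h | h
  · rw [h1 h]
    exact mul_add_mul_le_of_le h.le hu
  · rw [h0 h]
    simp only [mul_zero, add_zero, zero_add]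
    gcongr

lemma eq_of_mul_add_mul_eq {f u W e : ℝ≥0∞} (hf : f ≠ ⊤) (hW : W ≠ ⊤) (hu : u ≤ 1)
    (h1 : W < f → e = 1) (h0 : f ≤ W → e = 0) (hne : f ≠ W)
    (h : f * u + W * e = f * e + W * u) : u = e := by
  have hut : u ≠ ⊤ := ne_top_of_le_ne_top ENNReal.one_ne_top hu
  rcases lt_or_ge W f with hlt | hle
  · rw [h1 hlt] at h ⊢
    lift f to ℝ≥0 using hf
    lift W to ℝ≥0 using hW
    lift u to ℝ≥0 using hut
    norm_cast at *
    have hlt' : (W : ℝ) < f := hlt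
    have h' : (f : ℝ) * u + W * 1 = f * 1 + W * u := by exact_mod_cast h
    have : ((f : ℝ) - W) * (u - 1) = 0 := by linarith
    rcases mul_eq_zero.1 this with h3 | h3
    · linarith
    · exact_mod_cast (by linarith : (u : ℝ) = 1)
  · rw [h0 hle] at h ⊢
    have hlt : f < W := lt_of_le_of_ne hle hne
    lift f to ℝ≥0 using hf
    lift W to ℝ≥0 using hW
    lift u to ℝ≥0 using hut
    norm_cast at *
    have hlt' : (f : ℝ) < W := hlt
    have h' : (f : ℝ) * u + W * 0 = f * 0 + W * u := by exact_mod_cast h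
    have : ((f : ℝ) - W) * u = 0 := by linarith
    rcases mul_eq_zero.1 this with h3 | h3
    · linarith
    · exact_mod_cast h3

lemma superlevel_isSteiner {u : ℝ × ℝ → ℝ≥0∞} (h : AESteiner u) (hu : Measurable u) (W : ℝ≥0∞) :
    IsSteiner ({x ∈ H | W < relPot u x}.indicator 1) := by
  have hm : MeasurableSet {x ∈ H | W < relPot u x} :=
    measurableSet_H.inter (measurableSet_lt measurable_const (relPot_measurable hu))
  refine ⟨measurable_one.indicator hm, fun x => indicator_le_self' (by simp) x, ?_⟩
  intro a b t hab
  by_cases hb : (b, t) ∈ {x ∈ H | W < relPot u x}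
  · have ha : (a, t) ∈ {x ∈ H | W < relPot u x} :=
      ⟨hb.1, hb.2.trans_le (h.relPot_anti hu hb.1 hab)⟩
    simp only [indicator_of_mem ha, indicator_of_mem hb, Pi.one_apply, le_refl]
  · simp only [indicator_of_notMem hb, zero_le]

lemma levelSet_null {u : ℝ × ℝ → ℝ≥0∞} (h : AESteiner u) (hu : Measurable u)
    (hu1 : ∀ y, u y ≤ 1) (hP : ∫⁻ y, u y ∂impulseMeasure ≠ ⊤) (hP0 : ∫⁻ y, u y ∂impulseMeasure ≠ 0)
    {A : ℝ} (hA : ∀ᵐ y ∂impulseMeasure, A < |y.1| → u y = 0) {W : ℝ≥0∞} (hW : W ≠ ⊤) :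
    ∀ᵐ x ∂impulseMeasure, relPot u x ≠ W := by
  have hfm := relPot_measurable hu
  have hinj : ∀ a b t : ℝ, 0 < t → 0 ≤ a → a < b → relPot u (a, t) = W → relPot u (b, t) = W →
      False := by
    intro a b t ht ha hab h1 h2
    refine hP0 (h.lintegral_eq_zero hu hP (m := (a + b) / 2) (by linarith) hA ?_)
    refine h.symm_of_relPot_eq hu hu1 ht ?_ hab.ne (h1.trans h2.symm) (by rwa [h1])
    rw [abs_of_nonneg ha, abs_of_nonneg (ha.trans hab.le)]
    exact hab.le
  have heven : ∀ a t : ℝ, 0 < t → relPot u (-a, t) = relPot u (a, t) := fun a t ht =>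
    le_antisymm (h.relPot_anti hu ht (by simp)) (h.relPot_anti hu ht (by simp))
  set S : Set (ℝ × ℝ) := {x ∈ H | relPot u x = W} with hS
  have hSm : MeasurableSet S :=
    measurableSet_H.inter (measurableSet_eq_fun hfm measurable_const)
  have hS0 : volume S = 0 := by
    rw [Measure.volume_eq_prod, Measure.prod_apply_symm hSm]
    have hslice : ∀ t : ℝ, volume ((fun a : ℝ => (a, t)) ⁻¹' S) = 0 := by
      intro t
      have hsub : ∀ T : Set ℝ, (∀ a ∈ T, ∀ b ∈ T, a < b → False) → T.Subsingleton := by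
        intro T hT a ha b hb
        rcases lt_trichotomy a b with hlt | heq | hgt
        · exact (hT a ha b hb hlt).elim
        · exact heq
        · exact (hT b hb a ha hgt).elim
      have h1 : ((fun a : ℝ => (a, t)) ⁻¹' S ∩ Ici 0).Subsingleton :=
        hsub _ fun a ha b hb hlt => hinj a b t ha.1.1 ha.2 hlt ha.1.2 hb.1.2
      have h2 : ((fun a : ℝ => (a, t)) ⁻¹' S ∩ Iic 0).Subsingleton :=
        hsub _ fun a ha b hb hlt => hinj (-b) (-a) t ha.1.1 (by simpa using hb.2) (by linarith)
          ((heven b t ha.1.1).trans hb.1.2) ((heven a t ha.1.1).trans ha.1.2)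
      refine measure_mono_null ?_
        (measure_union_null (h1.measure_zero volume) (h2.measure_zero volume))
      intro a ha
      rcases le_total 0 a with h | h
      · exact Or.inl ⟨ha, h⟩
      · exact Or.inr ⟨ha, h⟩
    simp [hslice]
  have hae : ∀ᵐ x : ℝ × ℝ, x ∉ S := by simpa [ae_iff] using hS0
  filter_upwards [ae_impulseMeasure_of_ae hae, ae_mem_H] with x hx hxH hc
  exact hx ⟨hxH, hc⟩

/-- Existence of an energy maximizing patch. -/
theorem exists_maximizing_patch : ∃ Ω : Set (ℝ × ℝ), MeasurableSet Ω ∧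
    IsSteiner (Ω.indicator 1) ∧ impulseMeasure Ω = 1 ∧
    dblEnergy (Ω.indicator 1) = maxDblEnergy ∧
    Ω = {x ∈ H | ENNReal.ofReal patchSpeed < relPot (Ω.indicator 1) x} ∧ ∃ A, Ω ⊆ box A := by
  obtain ⟨ω, hω, hP, hC, u, hu, hu1, hlim⟩ := exists_maximizing_seq
  set W := ENNReal.ofReal patchSpeed with hW
  set f := relPot u with hf
  have hfm : Measurable f := relPot_measurable hu
  have huP := hlim.lintegral_le hP
  have hst : AESteiner u := hlim.aeSteiner hu (fun n => (hω n).measurable) fun n => (hω n).aeSteiner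
  have hf9 : ∀ x ∈ H, f x ≤ 9 := fun x hx => relPot_le_nine hu hu1 hx huP
  set Ω := {x ∈ H | W < f x} with hΩ
  have hΩm : MeasurableSet Ω := measurableSet_H.inter (measurableSet_lt measurable_const hfm)
  have hη : IsSteiner (Ω.indicator 1) := superlevel_isSteiner hst hu W
  have htail : ∀ ε : ℝ, 0 < ε → ∃ A : ℝ, 0 < A ∧ ∀ x ∈ H, (A ≤ |x.1| ∨ A ≤ x.2) →
      f x ≤ ENNReal.ofReal ε := by
    intro ε hε
    obtain ⟨A, hA, h⟩ := exists_relPot_tail hε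
    refine ⟨A, hA, fun x hx hxA => ?_⟩
    exact le_of_tendsto' (hlim.tendsto_relPot hu hu1 (fun n => (hω n).le_one) hP hx)
      fun n => h _ (hω n) (hP n) x hx hxA
  obtain ⟨A, hA, hAt⟩ := htail patchSpeed patchSpeed_pos
  have hΩA : Ω ⊆ box A := by
    intro x hx
    by_contra hxA
    exact absurd (hAt x hx.1 (notMem_box hx.1 hxA)) (not_le.2 hx.2)
  have hΩtop : impulseMeasure Ω ≠ ⊤ := measure_ne_top_of_subset hΩA (impulseMeasure_box_ne_top A)
  have hηP : ∫⁻ y, Ω.indicator 1 y ∂impulseMeasure = impulseMeasure Ω := lintegral_indicator_one hΩm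
  have hvar := variation_le hω hP hC hu hu1 hlim hη (by rwa [hηP])
  have hCI : maxDblEnergy ≤ ∫⁻ x, f x * u x ∂impulseMeasure :=
    le_lintegral_of_weakLim hω hP hC hu hu1 hlim
  rw [hηP, ← hf] at hvar
  set I := ∫⁻ x, f x * u x ∂impulseMeasure with hI
  set J := ∫⁻ x, f x * Ω.indicator 1 x ∂impulseMeasure with hJ
  set P := ∫⁻ x, u x ∂impulseMeasure with hPdef
  set p := impulseMeasure Ω with hp
  have hηm := hη.measurable
  have hItop : I ≠ ⊤ := by
    have : I ≤ ∫⁻ x, 9 * u x ∂impulseMeasure := by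
      apply lintegral_mono_ae
      filter_upwards [ae_mem_H] with x hx
      gcongr
      exact hf9 x hx
    refine ne_top_of_le_ne_top ?_ this
    rw [lintegral_const_mul _ hu]
    exact ENNReal.mul_ne_top (by norm_num) (ne_top_of_le_ne_top ENNReal.one_ne_top huP)
  have hJtop : J ≠ ⊤ := by
    have : J ≤ ∫⁻ x, 9 * Ω.indicator 1 x ∂impulseMeasure := by
      apply lintegral_mono_ae
      filter_upwards [ae_mem_H] with x hx
      gcongr
      exact hf9 x hx
    refine ne_top_of_le_ne_top ?_ this
    rw [lintegral_const_mul _ hηm, hηP]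
    exact ENNReal.mul_ne_top (by norm_num) hΩtop
  have hPtop : P ≠ ⊤ := ne_top_of_le_ne_top ENNReal.one_ne_top huP
  have h1 : ∀ x ∈ H, W < f x → Ω.indicator (1 : ℝ × ℝ → ℝ≥0∞) x = 1 := fun x hx h => by
    have : x ∈ Ω := ⟨hx, h⟩
    simp [this]
  have h0 : ∀ x, f x ≤ W → Ω.indicator (1 : ℝ × ℝ → ℝ≥0∞) x = 0 := fun x h => by
    have : x ∉ Ω := fun hx => absurd hx.2 (not_lt.2 h)
    simp [this]
  have hle : ∀ᵐ x ∂impulseMeasure, f x * u x + W * Ω.indicator 1 x ≤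
      f x * Ω.indicator 1 x + W * u x := by
    filter_upwards [ae_mem_H] with x hx
    exact mul_add_mul_le_of_indicator (hu1 x) (h1 x hx) (h0 x)
  have hint1 : ∫⁻ x, (f x * u x + W * Ω.indicator 1 x) ∂impulseMeasure = I + W * p := by
    rw [lintegral_add_left (by fun_prop), lintegral_const_mul _ hηm, hηP]
  have hint2 : ∫⁻ x, (f x * Ω.indicator 1 x + W * u x) ∂impulseMeasure = J + W * P := by
    rw [lintegral_add_left (by fun_prop), lintegral_const_mul _ hu]
  have hIJ := lintegral_mono_ae hle
  rw [hint1, hint2] at hIJ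
  have hWr : W.toReal = patchSpeed := ENNReal.toReal_ofReal patchSpeed_pos.le
  have hWtop : W ≠ ⊤ := ENNReal.ofReal_ne_top
  have hIJr : I.toReal + patchSpeed * p.toReal ≤ J.toReal + patchSpeed * P.toReal := by
    have := ENNReal.toReal_mono (by finiteness) hIJ
    rwa [ENNReal.toReal_add (by finiteness) (by finiteness),
      ENNReal.toReal_add (by finiteness) (by finiteness), ENNReal.toReal_mul, ENNReal.toReal_mul,
      hWr] at this
  have hCr : maxDblEnergy.toReal ≤ I.toReal := ENNReal.toReal_mono hItop hCI
  have hPr : P.toReal ≤ 1 := by simpa using ENNReal.toReal_mono ENNReal.one_ne_top huP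
  have hWpos := patchSpeed_pos
  have hWC : maxDblEnergy.toReal = 3 / 2 * patchSpeed := by unfold patchSpeed; ring
  have hP1 : P.toReal = 1 := by
    refine le_antisymm hPr ?_
    by_contra! hc
    nlinarith
  have hIC : I.toReal = maxDblEnergy.toReal := by
    rw [hP1] at hIJr
    linarith
  have hPone : P = 1 := by
    rw [← ENNReal.ofReal_toReal hPtop, hP1, ENNReal.ofReal_one]
  have hICe : I = maxDblEnergy := by
    rw [← ENNReal.ofReal_toReal hItop, hIC, ENNReal.ofReal_toReal maxDblEnergy_ne_top]
  have hJI : J + W * P ≤ I + W * p := by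
    rw [← ENNReal.toReal_le_toReal (by finiteness) (by finiteness),
      ENNReal.toReal_add (by finiteness) (by finiteness),
      ENNReal.toReal_add (by finiteness) (by finiteness), ENNReal.toReal_mul, ENNReal.toReal_mul,
      hWr, hP1, hIC]
    linarith
  have hae := ae_eq_of_ae_le_of_lintegral_le hle (by rw [hint1]; finiteness) (by fun_prop)
    (by rw [hint1, hint2]; exact hJI)
  have hne_top : ∀ x ∈ H, f x ≠ ⊤ := fun x hx => ne_top_of_le_ne_top (by norm_num) (hf9 x hx)
  obtain ⟨A', -, hAt'⟩ := htail (patchSpeed / 2) (by positivity)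
  have hsupp : ∀ᵐ y ∂impulseMeasure, A' < |y.1| → u y = 0 := by
    filter_upwards [hae, ae_mem_H] with y hy hyH hyA
    have hlt : f y < W := (hAt' y hyH (Or.inl hyA.le)).trans_lt
      ((ENNReal.ofReal_lt_ofReal_iff hWpos).2 (by linarith))
    rw [eq_of_mul_add_mul_eq (hne_top y hyH) hWtop (hu1 y) (h1 y hyH) (h0 y) hlt.ne hy]
    exact h0 y hlt.le
  have hlevel := levelSet_null hst hu hu1 hPtop (by rw [← hPdef, hPone]; exact one_ne_zero) hsupp
    hWtop
  have huΩ : u =ᵐ[impulseMeasure] Ω.indicator 1 := by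
    filter_upwards [hae, ae_mem_H, hlevel] with y hy hyH hne
    exact eq_of_mul_add_mul_eq (hne_top y hyH) hWtop (hu1 y) (h1 y hyH) (h0 y) hne hy
  have hrel : relPot (Ω.indicator 1) = f := by
    ext x
    rw [hf]
    unfold relPot
    apply lintegral_congr_ae
    filter_upwards [huΩ] with y hy
    rw [hy]
  refine ⟨Ω, hΩm, hη, ?_, ?_, ?_, A, hΩA⟩
  · rw [← hp, ← hηP, ← lintegral_congr_ae huΩ, ← hPdef, hPone]
  · rw [← hICe, hI]
    unfold dblEnergy
    rw [hrel]
    apply lintegral_congr_ae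
    filter_upwards [huΩ] with y hy
    rw [hy]
  · rw [hrel]

/-! ### The maximizing patch touches the axis -/

/-- The Poisson kernel of the upper half plane. -/
def halfPlanePoisson (s t : ℝ) : ℝ := t / (π * (s ^ 2 + t ^ 2))

@[fun_prop]
lemma Measurable.halfPlanePoisson {α : Type*} [MeasurableSpace α] {f g : α → ℝ}
    (hf : Measurable f) (hg : Measurable g) : Measurable fun a => halfPlanePoisson (f a) (g a) := by
  unfold _root_.halfPlanePoisson
  fun_prop

lemma lintegral_halfPlanePoisson_le {g : ℝ → ℝ≥0∞} (hg : Measurable g)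
    (hanti : ∀ a b, |a| ≤ |b| → g b ≤ g a) (a : ℝ) {t T : ℝ} (ht : 0 < t) (hT : t ≤ T) :
    ∫⁻ s, ENNReal.ofReal (halfPlanePoisson (a - s) T) * g s ≤
      ∫⁻ s, ENNReal.ofReal (halfPlanePoisson s t) * g s := by
  have hT0 : 0 < T := ht.trans_le hT
  have hPanti : ∀ a b, |a| ≤ |b| → ENNReal.ofReal (halfPlanePoisson b T) ≤
      ENNReal.ofReal (halfPlanePoisson a T) := by
    intro a b hab
    have := sq_le_sq.2 hab
    unfold halfPlanePoisson
    apply ENNReal.ofReal_le_ofReal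
    gcongr
  calc ∫⁻ s, ENNReal.ofReal (halfPlanePoisson (a - s) T) * g s
      ≤ ∫⁻ s, ENNReal.ofReal (halfPlanePoisson s T) * g s := by
        refine lintegral_comp_mul_le (p := fun s => ENNReal.ofReal (halfPlanePoisson s T))
          (Measure.measurePreserving_sub_left volume a) (fun x => by ring) (by fun_prop) hg
          (Eventually.of_forall fun s => ?_)
        rcases le_total |s| |a - s| with h | h
        · exact mul_add_mul_le_of_le (hPanti _ _ h) (hanti _ _ h)
        · have := mul_add_mul_le_of_le (hPanti _ _ h) (hanti _ _ h)
          rw [add_comm] at this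
          exact this.trans (add_comm _ _).le
    _ = ∫⁻ s, ENNReal.ofReal (halfPlanePoisson s t) * g (T / t * s) := by
        have hl : T / t ≠ 0 := by positivity
        have h1 := Real.smul_map_volume_mul_left hl
        conv_lhs => rw [← h1]
        rw [lintegral_smul_measure, lintegral_map (by fun_prop) (by fun_prop),
          smul_eq_mul, ← lintegral_const_mul _ (by fun_prop)]
        congr 1 with s
        rw [← mul_assoc, ← ENNReal.ofReal_mul (abs_nonneg _), abs_of_pos (by positivity)]
        congr 2
        unfold halfPlanePoisson
        have : 0 < s ^ 2 + t ^ 2 := by positivity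
        have : 0 < (T / t * s) ^ 2 + T ^ 2 := by positivity
        have h3 : (T / t * s) ^ 2 + T ^ 2 = (T / t) ^ 2 * (s ^ 2 + t ^ 2) := by
          field_simp
        rw [h3]
        field_simp
    _ ≤ _ := by
        gcongr with s
        apply hanti
        rw [abs_mul, abs_of_pos (show 0 < T / t by positivity)]
        exact le_mul_of_one_le_left (abs_nonneg _) ((one_le_div ht).2 hT)

lemma IsSteiner.lintegral_halfPlanePoisson_le {ω : ℝ × ℝ → ℝ≥0∞} (h : IsSteiner ω)
    (hH : ∀ y ∉ H, ω y = 0) (a : ℝ) {c : ℝ} (hc : 0 ≤ c) :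
    ∫⁻ y, ENNReal.ofReal (halfPlanePoisson (a - y.1) (y.2 + c)) * ω y ≤
      ∫⁻ y, ENNReal.ofReal (halfPlanePoisson y.1 y.2) * ω y := by
  have hm := h.measurable
  rw [Measure.volume_eq_prod, lintegral_prod_symm' _ (by fun_prop),
    lintegral_prod_symm' _ (by fun_prop)]
  refine lintegral_mono fun t => ?_
  rcases le_or_gt t 0 with ht | ht
  · have : ∀ s, ω (s, t) = 0 := fun s => hH _ (not_lt.2 ht)
    simp [this]
  · exact _root_.lintegral_halfPlanePoisson_le (g := fun s => ω (s, t)) (T := t + c) (by fun_prop)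
      (fun a b hab => h.anti a b t hab) a ht (by linarith)

lemma G_le_G_sub_add {x y : ℝ × ℝ} {h : ℝ} (hh : 0 < h) (hx : 2 * h ≤ x.2) (hy : 2 * h ≤ y.2)
    (hne : y ≠ x) : G x y ≤ G (x - (0, h)) (y - (0, h)) +
      3 * h / 2 * halfPlanePoisson (x.1 - y.1) (y.2 + (x.2 - 2 * h)) := by
  have hd := distSq_pos hne
  unfold G halfPlanePoisson
  simp only [Prod.fst_sub, Prod.snd_sub, sub_zero]
  have e1 : x.2 - h - (y.2 - h) = x.2 - y.2 := by ring
  rw [e1]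
  set D := (x.1 - y.1) ^ 2 + (x.2 - y.2) ^ 2 with hD
  set T := y.2 + (x.2 - 2 * h) with hT
  set S := (x.1 - y.1) ^ 2 + T ^ 2 with hS
  have hT2 : 2 * h ≤ T := by linarith
  have hSp : 0 < S := by
    have : 0 < T := by linarith
    positivity
  have h1 : 1 + 4 * (x.2 - h) * (y.2 - h) / D = S / D := by
    field_simp
    rw [hS, hD, hT]
    ring
  have h2 : 1 + 4 * x.2 * y.2 / D = (S / D) * ((S + 4 * h * T + 4 * h ^ 2) / S) := by
    field_simp
    rw [hS, hD, hT]
    ring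
  have hT0 : 0 < T := by linarith
  rw [h1, h2, Real.log_mul (by positivity) (by positivity), mul_add]
  refine add_le_add_right ?_ _
  have h3 : Real.log ((S + 4 * h * T + 4 * h ^ 2) / S) ≤ 6 * h * T / S := by
    have := Real.log_le_sub_one_of_pos (x := (S + 4 * h * T + 4 * h ^ 2) / S) (by positivity)
    refine this.trans ?_
    rw [div_sub_one hSp.ne']
    gcongr
    nlinarith
  calc 1 / (4 * π) * Real.log ((S + 4 * h * T + 4 * h ^ 2) / S) ≤ 1 / (4 * π) * (6 * h * T / S) := by
        gcongr
    _ = 3 * h / 2 * (T / (π * S)) := by field_simp; ring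

lemma dblEnergy_indicator {A : Set (ℝ × ℝ)} (hA : MeasurableSet A) (hAH : A ⊆ H) :
    dblEnergy (A.indicator 1) = ∫⁻ x in A, ∫⁻ y in A, ENNReal.ofReal (G x y) := by
  have hm : Measurable (A.indicator (1 : ℝ × ℝ → ℝ≥0∞)) := measurable_one.indicator hA
  unfold dblEnergy relPot
  rw [lintegral_impulseMeasure, ← lintegral_indicator hA]
  congr 1 with x
  by_cases hx : x ∈ A
  · rw [indicator_of_mem hx, indicator_of_mem hx, lintegral_impulseMeasure, ← lintegral_indicator hA]
    rw [Pi.one_apply, mul_one, ← lintegral_const_mul _ (by fun_prop)]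
    congr 1 with y
    by_cases hy : y ∈ A
    · rw [indicator_of_mem hy, indicator_of_mem hy, Pi.one_apply, mul_one]
      exact ofReal_mul_greenKernel_mul (hAH hx) (hAH hy)
    · simp [indicator_of_notMem hy]
  · simp [indicator_of_notMem hx]

/-- The relative potential at the origin of the patch `Ω`. -/
def originPot (Ω : Set (ℝ × ℝ)) : ℝ≥0∞ := ∫⁻ y in Ω, ENNReal.ofReal (halfPlanePoisson y.1 y.2)

lemma dblEnergy_le_dblEnergy_lowered_add {A Ω : Set (ℝ × ℝ)} (hA : MeasurableSet A)
    (hΩ : MeasurableSet Ω) (hAΩ : A ⊆ Ω) (hΩH : Ω ⊆ H)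
    (hS : IsSteiner (Ω.indicator 1)) {h : ℝ} (hh : 0 < h) (hAh : ∀ x ∈ A, 2 * h < x.2) :
    dblEnergy (A.indicator 1) ≤ dblEnergy (((fun x => x + (0, h)) ⁻¹' A).indicator 1) +
      ENNReal.ofReal (3 * h / 2) * volume A * originPot Ω := by
  set B := (fun x : ℝ × ℝ => x + (0, h)) ⁻¹' A with hB
  have hBm : MeasurableSet B := hA.preimage (by fun_prop)
  have hBH : B ⊆ H := by
    intro x hx
    have := hAh _ hx
    simp only [Prod.snd_add] at this
    show 0 < x.2
    linarith
  have hmp : MeasurePreserving (fun x : ℝ × ℝ => x + (0, h)) volume volume :=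
    measurePreserving_add_right volume _
  have hGm := measurable_G
  have hGm' : ∀ x, Measurable fun y => G x y := fun x => hGm.comp (by fun_prop : Measurable fun y => (x, y))
  have hBE : dblEnergy (B.indicator 1) =
      ∫⁻ x in A, ∫⁻ y in A, ENNReal.ofReal (G (x - (0, h)) (y - (0, h))) := by
    rw [dblEnergy_indicator hBm hBH, ← hmp.setLIntegral_comp_preimage hA]
    · congr 1 with x
      rw [← hmp.setLIntegral_comp_preimage hA]
      · simp [hB]
      · exact (hGm.comp (by fun_prop : Measurable fun y : ℝ × ℝ =>
          (x + (0, h) - (0, h), y - (0, h)))).ennreal_ofReal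
    · apply Measurable.lintegral_prod_right'
        (f := fun p : (ℝ × ℝ) × (ℝ × ℝ) => ENNReal.ofReal (G (p.1 - (0, h)) (p.2 - (0, h))))
      exact (hGm.comp (by fun_prop : Measurable fun p : (ℝ × ℝ) × (ℝ × ℝ) =>
        (p.1 - (0, h), p.2 - (0, h)))).ennreal_ofReal
  have hinner : ∀ x ∈ A, ∫⁻ y in A, ENNReal.ofReal (G x y) ≤
      (∫⁻ y in A, ENNReal.ofReal (G (x - (0, h)) (y - (0, h)))) +
        ENNReal.ofReal (3 * h / 2) * originPot Ω := by
    intro x hx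
    have hx2 := hAh x hx
    have hGm2 : Measurable fun y => G (x - (0, h)) (y - (0, h)) :=
      hGm.comp (by fun_prop : Measurable fun y : ℝ × ℝ => (x - (0, h), y - (0, h)))
    have hpoint : ∫⁻ y in A, ENNReal.ofReal (G x y) ≤
        ∫⁻ y in A, (ENNReal.ofReal (G (x - (0, h)) (y - (0, h))) + ENNReal.ofReal (3 * h / 2) *
          ENNReal.ofReal (halfPlanePoisson (x.1 - y.1) (y.2 + (x.2 - 2 * h)))) := by
      apply lintegral_mono_ae
      have hne : ∀ᵐ y : ℝ × ℝ, y ≠ x := by simp [ae_iff]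
      filter_upwards [ae_restrict_mem hA, ae_restrict_of_ae hne] with y hy hyx
      rw [← ENNReal.ofReal_mul (by positivity)]
      exact (ENNReal.ofReal_le_ofReal (G_le_G_sub_add hh hx2.le (hAh y hy).le hyx)).trans
        ENNReal.ofReal_add_le
    refine hpoint.trans ?_
    rw [lintegral_add_left (by fun_prop), lintegral_const_mul _ (by fun_prop)]
    gcongr
    calc _ ≤ ∫⁻ y in Ω, ENNReal.ofReal (halfPlanePoisson (x.1 - y.1) (y.2 + (x.2 - 2 * h))) :=
          lintegral_mono_set hAΩ
      _ = ∫⁻ y, ENNReal.ofReal (halfPlanePoisson (x.1 - y.1) (y.2 + (x.2 - 2 * h))) *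
          Ω.indicator 1 y := by
          rw [← lintegral_indicator hΩ]
          congr 1 with y
          by_cases hy : y ∈ Ω <;> simp [hy]
      _ ≤ ∫⁻ y, ENNReal.ofReal (halfPlanePoisson y.1 y.2) * Ω.indicator 1 y :=
          hS.lintegral_halfPlanePoisson_le
            (fun y hy => indicator_of_notMem (fun hc => hy (hΩH hc)) _) _ (by linarith)
      _ = originPot Ω := by
          unfold originPot
          rw [← lintegral_indicator hΩ]
          congr 1 with y
          by_cases hy : y ∈ Ω <;> simp [hy]
  rw [dblEnergy_indicator hA (hAΩ.trans hΩH), hBE]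
  calc _ ≤ ∫⁻ x in A, ((∫⁻ y in A, ENNReal.ofReal (G (x - (0, h)) (y - (0, h)))) +
        ENNReal.ofReal (3 * h / 2) * originPot Ω) := setLIntegral_mono' hA hinner
    _ = _ := by
      rw [lintegral_add_right _ measurable_const, setLIntegral_const]
      ring

lemma dblEnergy_indicator_le_add {Ω A L : Set (ℝ × ℝ)} (hA : MeasurableSet A)
    (hL : MeasurableSet L) (hd : Disjoint A L) (hΩ : Ω = A ∪ L) (hP : impulseMeasure Ω ≤ 1) :
    dblEnergy (Ω.indicator 1) ≤ dblEnergy (A.indicator 1) + 18 * impulseMeasure L := by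
  have hΩm : MeasurableSet Ω := hΩ ▸ hA.union hL
  have hmA : Measurable (A.indicator (1 : ℝ × ℝ → ℝ≥0∞)) := measurable_one.indicator hA
  have hmL : Measurable (L.indicator (1 : ℝ × ℝ → ℝ≥0∞)) := measurable_one.indicator hL
  have hmΩ : Measurable (Ω.indicator (1 : ℝ × ℝ → ℝ≥0∞)) := measurable_one.indicator hΩm
  have hsplit : ∀ x, Ω.indicator (1 : ℝ × ℝ → ℝ≥0∞) x =
      A.indicator 1 x + L.indicator 1 x := fun x => by
    rw [hΩ, indicator_union_of_disjoint hd]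
  have hpA := relPot_measurable hmA
  have hpΩ := relPot_measurable hmΩ
  have hL9 : ∫⁻ x, relPot (Ω.indicator 1) x * L.indicator 1 x ∂impulseMeasure ≤
      9 * impulseMeasure L := by
    calc _ ≤ ∫⁻ x, 9 * L.indicator 1 x ∂impulseMeasure := by
          apply lintegral_mono_ae
          filter_upwards [ae_mem_H] with x hx
          gcongr
          refine relPot_le_nine hmΩ (fun y => indicator_le_self' (by simp) y) hx ?_
          rwa [lintegral_indicator_one hΩm]
      _ = _ := by rw [lintegral_const_mul _ hmL, lintegral_indicator_one hL]
  have h1 : dblEnergy (Ω.indicator 1) =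
      ∫⁻ x, relPot (Ω.indicator 1) x * A.indicator 1 x ∂impulseMeasure +
        ∫⁻ x, relPot (Ω.indicator 1) x * L.indicator 1 x ∂impulseMeasure := by
    rw [← lintegral_add_left (by fun_prop)]
    unfold dblEnergy
    congr 1 with x
    rw [hsplit x, mul_add]
  have h2 : ∫⁻ x, relPot (Ω.indicator 1) x * A.indicator 1 x ∂impulseMeasure =
      dblEnergy (A.indicator 1) +
        ∫⁻ x, relPot (A.indicator 1) x * L.indicator 1 x ∂impulseMeasure := by
    rw [lintegral_relPot_mul_comm hmΩ hmA]
    unfold dblEnergy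
    rw [← lintegral_add_left (by fun_prop)]
    congr 1 with x
    rw [hsplit x, mul_add]
  have h3 : ∫⁻ x, relPot (A.indicator 1) x * L.indicator 1 x ∂impulseMeasure ≤
      ∫⁻ x, relPot (Ω.indicator 1) x * L.indicator 1 x ∂impulseMeasure := by
    gcongr with x
    exact relPot_mono (fun y => by rw [hsplit y]; exact le_self_add) x
  rw [h1, h2]
  calc _ ≤ dblEnergy (A.indicator 1) + 9 * impulseMeasure L + 9 * impulseMeasure L := by
        gcongr
        exact h3.trans hL9
    _ = _ := by ring

lemma impulseMeasure_lowered_add {A : Set (ℝ × ℝ)} (hA : MeasurableSet A) {h : ℝ} (hh : 0 < h)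
    (hAh : ∀ x ∈ A, 2 * h < x.2) :
    impulseMeasure ((fun x => x + (0, h)) ⁻¹' A) + ENNReal.ofReal h * volume A =
      impulseMeasure A := by
  have hmp : MeasurePreserving (fun x : ℝ × ℝ => x + (0, h)) volume volume :=
    measurePreserving_add_right volume _
  have hBm : MeasurableSet ((fun x : ℝ × ℝ => x + (0, h)) ⁻¹' A) := hA.preimage (by fun_prop)
  have hμ : ∀ {S : Set (ℝ × ℝ)}, MeasurableSet S →
      impulseMeasure S = ∫⁻ x in S, ENNReal.ofReal x.2 * 1 := fun hS => by
    rw [← setLIntegral_impulseMeasure hS (fun _ => 1), setLIntegral_one]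
  rw [hμ hBm, hμ hA]
  have h1 : ∫⁻ x in (fun x : ℝ × ℝ => x + (0, h)) ⁻¹' A, ENNReal.ofReal x.2 * 1 =
      ∫⁻ x in A, ENNReal.ofReal (x.2 - h) := by
    rw [← hmp.setLIntegral_comp_preimage hA (by fun_prop)]
    simp
  rw [h1, ← setLIntegral_const, ← lintegral_add_left (by fun_prop)]
  apply setLIntegral_congr_fun hA
  intro x hx
  have := hAh x hx
  simp only [mul_one]
  rw [← ENNReal.ofReal_add (by linarith) hh.le]
  congr 1
  ring

lemma lowering_estimate {Ω : Set (ℝ × ℝ)} (hΩ : MeasurableSet Ω) (hS : IsSteiner (Ω.indicator 1))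
    (hP : impulseMeasure Ω = 1) (hE : dblEnergy (Ω.indicator 1) = maxDblEnergy) {A₀ : ℝ}
    (hA₀ : 0 < A₀) (hbox : Ω ⊆ box A₀) {W : ℝ} (hW : 0 ≤ W)
    (hle : originPot Ω ≤ ENNReal.ofReal W) {h : ℝ} (hh : 0 < h) :
    ∃ m : ℝ, volume.real Ω - 4 * A₀ * h ≤ m ∧ 0 ≤ m ∧ m ≤ volume.real Ω ∧ h * m ≤ 1 ∧
      maxDblEnergy.toReal ≤ maxDblEnergy.toReal * (1 - h * m / 3) ^ 4 + 3 * h / 2 * m * W +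
        144 * A₀ * h ^ 2 := by
  have hΩH : Ω ⊆ H := hbox.trans (box_subset_H _)
  set A := Ω ∩ {x | 2 * h < x.2} with hAdef
  set L := Ω ∩ {x | x.2 ≤ 2 * h} with hLdef
  have hA : MeasurableSet A := hΩ.inter (measurableSet_lt (by fun_prop) (by fun_prop))
  have hL : MeasurableSet L := hΩ.inter (measurableSet_le (by fun_prop) (by fun_prop))
  have hAΩ : A ⊆ Ω := inter_subset_left
  have hAh : ∀ x ∈ A, 2 * h < x.2 := fun x hx => hx.2
  have hd : Disjoint A L := by
    rw [Set.disjoint_left]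
    exact fun x hx hx' => not_le_of_gt (a := 2 * h) (b := x.2) hx.2 hx'.2
  have hU : Ω = A ∪ L := by
    rw [hAdef, hLdef, ← inter_union_distrib_left]
    ext x
    have := lt_or_ge (2 * h) x.2
    simp only [mem_inter_iff, mem_union, mem_ofPred_eq]
    tauto
  have hvL : volume L ≤ ENNReal.ofReal (4 * A₀ * h) := by
    have hsub : L ⊆ Icc (-A₀) A₀ ×ˢ Icc 0 (2 * h) := fun x hx =>
      ⟨⟨(hbox hx.1).1.1.le, (hbox hx.1).1.2.le⟩, (hbox hx.1).2.1.le, hx.2⟩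
    refine (measure_mono hsub).trans ?_
    rw [Measure.volume_eq_prod, Measure.prod_prod, Real.volume_Icc, Real.volume_Icc,
      ← ENNReal.ofReal_mul (by linarith)]
    apply ENNReal.ofReal_le_ofReal
    nlinarith
  have hμL : impulseMeasure L ≤ ENNReal.ofReal (8 * A₀ * h ^ 2) := by
    rw [← setLIntegral_one, setLIntegral_impulseMeasure hL]
    calc ∫⁻ x in L, ENNReal.ofReal x.2 * 1 ≤ ∫⁻ _ in L, ENNReal.ofReal (2 * h) := by
          apply setLIntegral_mono' hL
          intro x hx
          rw [mul_one]
          exact ENNReal.ofReal_le_ofReal hx.2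
      _ = ENNReal.ofReal (2 * h) * volume L := by rw [setLIntegral_const]
      _ ≤ ENNReal.ofReal (2 * h) * ENNReal.ofReal (4 * A₀ * h) := by gcongr
      _ = _ := by
        rw [← ENNReal.ofReal_mul (by positivity)]
        congr 1
        ring
  have hvΩ : volume Ω ≠ ⊤ := by
    refine ((measure_mono hbox).trans_lt ?_).ne
    unfold box
    rw [Measure.volume_eq_prod, Measure.prod_prod, Real.volume_Ioo, Real.volume_Ioo]
    exact ENNReal.mul_lt_top ENNReal.ofReal_lt_top ENNReal.ofReal_lt_top
  have hvA : volume A ≠ ⊤ := measure_ne_top_of_subset hAΩ hvΩ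
  set B := (fun x : ℝ × ℝ => x + (0, h)) ⁻¹' A with hB
  have hBm : MeasurableSet B := hA.preimage (by fun_prop)
  have hBS : IsSteiner (B.indicator 1) := by
    refine ⟨measurable_one.indicator hBm, fun x => indicator_le_self' (by simp) x, ?_⟩
    intro a b t hab
    by_cases hb : (b, t) ∈ B
    · have ha : (a, t) ∈ B := by
        simp only [hB, hAdef, mem_preimage, Prod.mk_add_mk, add_zero, mem_inter_iff,
          mem_ofPred_eq] at hb ⊢
        refine ⟨?_, hb.2⟩
        by_contra hc
        have := hS.anti a b (t + h) hab
        rw [indicator_of_mem hb.1, indicator_of_notMem hc] at this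
        simp at this
      simp only [indicator_of_mem ha, indicator_of_mem hb, Pi.one_apply, le_refl]
    · simp only [indicator_of_notMem hb, zero_le]
  have hμ := impulseMeasure_lowered_add hA hh hAh
  set m := (volume A).toReal with hm
  have hm0 : 0 ≤ m := ENNReal.toReal_nonneg
  have hmA : volume A = ENNReal.ofReal m := (ENNReal.ofReal_toReal hvA).symm
  have hsum : impulseMeasure B + ENNReal.ofReal (h * m) ≤ 1 := by
    rw [ENNReal.ofReal_mul hh.le, ← hmA, hμ, ← hP]
    exact measure_mono hAΩ
  have hhm : h * m ≤ 1 := by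
    have : ENNReal.ofReal (h * m) ≤ 1 := le_add_self.trans hsum
    simpa using this
  have hBle : impulseMeasure B ≤ ENNReal.ofReal ((1 - h * m / 3) ^ 3) := by
    have h1 : impulseMeasure B ≤ ENNReal.ofReal (1 - h * m) := by
      rw [ENNReal.ofReal_sub _ (by positivity), ENNReal.ofReal_one]
      exact ENNReal.le_sub_of_add_le_right ENNReal.ofReal_ne_top hsum
    refine h1.trans (ENNReal.ofReal_le_ofReal ?_)
    have h2 : 0 ≤ h * m := by positivity
    nlinarith [sq_nonneg (h * m)]
  have hEB := hBS.dblEnergy_le (s := 1 - h * m / 3) (by linarith)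
    (by rwa [lintegral_indicator_one hBm])
  have hEA := dblEnergy_le_dblEnergy_lowered_add hA hΩ hAΩ hΩH hS hh hAh
  have hEΩ := dblEnergy_indicator_le_add hA hL hd hU hP.le
  refine ⟨m, ?_, hm0, ?_, hhm, ?_⟩
  · have : volume Ω ≤ ENNReal.ofReal (m + 4 * A₀ * h) := by
      rw [ENNReal.ofReal_add hm0 (by positivity), ← hmA, hU]
      exact (measure_union_le _ _).trans (by gcongr)
    have := ENNReal.toReal_le_of_le_ofReal (by positivity) this
    have h2 : volume.real Ω = (volume Ω).toReal := rfl
    linarith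
  · exact ENNReal.toReal_mono hvΩ (measure_mono hAΩ)
  · have hfin := maxDblEnergy_ne_top
    have hs0 : 0 ≤ (1 - h * m / 3) ^ 4 := by positivity
    have key : maxDblEnergy ≤ ENNReal.ofReal (maxDblEnergy.toReal * (1 - h * m / 3) ^ 4 +
        3 * h / 2 * m * W + 144 * A₀ * h ^ 2) := by
      calc maxDblEnergy = dblEnergy (Ω.indicator 1) := hE.symm
        _ ≤ (ENNReal.ofReal ((1 - h * m / 3) ^ 4) * maxDblEnergy +
            ENNReal.ofReal (3 * h / 2) * ENNReal.ofReal m * ENNReal.ofReal W) +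
            18 * ENNReal.ofReal (8 * A₀ * h ^ 2) := by
            refine hEΩ.trans ?_
            gcongr
            refine hEA.trans ?_
            rw [hmA]
            gcongr
        _ = _ := by
            have e18 : (18 : ℝ≥0∞) = ENNReal.ofReal 18 := by simp
            have eC : maxDblEnergy = ENNReal.ofReal maxDblEnergy.toReal :=
              (ENNReal.ofReal_toReal hfin).symm
            have hC0 : 0 ≤ maxDblEnergy.toReal := ENNReal.toReal_nonneg
            conv_lhs => rw [eC, e18]
            rw [← ENNReal.ofReal_mul hs0, ← ENNReal.ofReal_mul (by positivity),
              ← ENNReal.ofReal_mul (by positivity), ← ENNReal.ofReal_mul (by positivity),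
              ← ENNReal.ofReal_add (by positivity) (by positivity),
              ← ENNReal.ofReal_add (by positivity) (by positivity)]
            congr 1
            ring
    have hC0 : 0 ≤ maxDblEnergy.toReal := ENNReal.toReal_nonneg
    exact ENNReal.toReal_le_of_le_ofReal (by positivity) key

theorem patchSpeed_lt_originPot {Ω : Set (ℝ × ℝ)} (hΩ : MeasurableSet Ω)
    (hS : IsSteiner (Ω.indicator 1)) (hP : impulseMeasure Ω = 1)
    (hE : dblEnergy (Ω.indicator 1) = maxDblEnergy) {A₀ : ℝ} (hbox : Ω ⊆ box A₀) :
    ENNReal.ofReal patchSpeed < originPot Ω := by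
  by_contra! hle
  have hΩne : Ω.Nonempty := nonempty_of_measure_ne_zero (μ := impulseMeasure) (by simp [hP])
  have hA₀ : 0 < A₀ := by
    obtain ⟨x, hx⟩ := hΩne
    exact (hbox hx).2.1.trans (hbox hx).2.2
  set V := volume.real Ω with hVdef
  set C := maxDblEnergy.toReal with hC
  have hC0 : 0 < C := ENNReal.toReal_pos maxDblEnergy_pos.ne' maxDblEnergy_ne_top
  have hWC : patchSpeed = 2 / 3 * C := rfl
  have hV : 0 < V := by
    refine ENNReal.toReal_pos ?_ ?_
    · intro h0
      have : impulseMeasure Ω = 0 := withDensity_absolutelyContinuous _ _ h0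
      simp [hP] at this
    · refine ((measure_mono hbox).trans_lt ?_).ne
      unfold box
      rw [Measure.volume_eq_prod, Measure.prod_prod, Real.volume_Ioo, Real.volume_Ioo]
      exact ENNReal.mul_lt_top ENNReal.ofReal_lt_top ENNReal.ofReal_lt_top
  set K := C * V ^ 2 + 144 * A₀ with hK
  have hK0 : 0 < K := by positivity
  set h := min (V / (8 * A₀)) (C * V / (12 * K)) with hh
  have hh0 : 0 < h := by positivity
  have hh1 : h * (8 * A₀) ≤ V := (le_div_iff₀ (by positivity)).1 (min_le_left _ _)
  have hh2 : h * (12 * K) ≤ C * V := (le_div_iff₀ (by positivity)).1 (min_le_right _ _)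
  obtain ⟨m, h1, h2, h3, h4, h5⟩ :=
    lowering_estimate hΩ hS hP hE hA₀ hbox patchSpeed_pos.le hle hh0
  rw [hWC] at h5
  have hpow : (1 - h * m / 3) ^ 4 ≤ 1 - 4 / 3 * (h * m) + 2 / 3 * (h * m) ^ 2 := by
    have hx0 : 0 ≤ h * m := by positivity
    have : 0 ≤ (h * m) ^ 3 * (12 - h * m) := by
      have : 0 ≤ 12 - h * m := by linarith
      positivity
    nlinarith
  have hm2 : m ^ 2 ≤ V ^ 2 := by gcongr
  have h6 : C ≤ C * (1 - 4 / 3 * (h * m) + 2 / 3 * (h * m) ^ 2) + 3 * h / 2 * m * (2 / 3 * C) +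
      144 * A₀ * h ^ 2 := by
    refine h5.trans ?_
    gcongr
  have h7 : h * (C * m / 3) ≤ h * (h * (2 / 3 * C * m ^ 2 + 144 * A₀)) := by nlinarith
  have h8 : C * m / 3 ≤ h * (2 / 3 * C * m ^ 2 + 144 * A₀) := le_of_mul_le_mul_left h7 hh0
  have h9 : h * (2 / 3 * C * m ^ 2 + 144 * A₀) ≤ h * K := by
    rw [hK]
    gcongr
    linarith
  have h10 : C * (V / 2) ≤ C * m := by
    gcongr
    linarith
  nlinarith [mul_pos hC0 hV]

/-! ### Regularity of the superlevel set -/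

lemma eventually_lt_lintegral_mul {k : ℝ × ℝ → ℝ × ℝ → ℝ≥0∞} (hk : ∀ x, Measurable (k x))
    {k₀ ω : ℝ × ℝ → ℝ≥0∞} (hω : Measurable ω) (hω1 : ∀ y, ω y ≤ 1) {l : Filter (ℝ × ℝ)}
    [l.IsCountablyGenerated]
    (hlim : ∀ᵐ y ∂impulseMeasure, Tendsto (fun x => k x y) l (𝓝 (k₀ y))) {c : ℝ≥0∞}
    (hc : c < ∫⁻ y, k₀ y * ω y ∂impulseMeasure) :
    ∀ᶠ x in l, c < ∫⁻ y, k x y * ω y ∂impulseMeasure := by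
  rcases l.eq_or_neBot with rfl | hl
  · simp
  refine eventually_lt_of_lt_liminf (hc.trans_le ?_)
  refine le_trans (le_of_eq ?_) (lintegral_liminf_le (u := l) (fun x => (hk x).mul hω))
  apply lintegral_congr_ae
  filter_upwards [hlim] with y hy
  exact (ENNReal.Tendsto.mul_const hy (Or.inr ((hω1 y).trans_lt ENNReal.one_lt_top).ne)).liminf_eq.symm

lemma isOpen_H : IsOpen H := isOpen_lt continuous_const continuous_snd

lemma isOpen_superlevel {ω : ℝ × ℝ → ℝ≥0∞} (hω : Measurable ω) (hω1 : ∀ y, ω y ≤ 1) (c : ℝ≥0∞) :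
    IsOpen {x ∈ H | c < relPot ω x} := by
  rw [isOpen_iff_mem_nhds]
  intro x hx
  have hx2 : 0 < x.2 := hx.1
  refine inter_mem (isOpen_H.mem_nhds hx.1) (eventually_lt_lintegral_mul (k := greenKernel)
    (fun x => by fun_prop) hω hω1 ?_ hx.2)
  filter_upwards [ae_mem_H, ae_impulseMeasure_ne x] with y hy hne
  have hy2 : 0 < y.2 := hy
  have hd := distSq_pos hne
  refine (ENNReal.continuous_ofReal.continuousAt.comp ?_ : ContinuousAt (fun x => greenKernel x y) x)
  unfold G
  have : 1 + 4 * x.2 * y.2 / ((x.1 - y.1) ^ 2 + (x.2 - y.2) ^ 2) ≠ 0 := by positivity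
  have h2 : x.2 * y.2 ≠ 0 := by positivity
  refine ContinuousAt.div (ContinuousAt.mul continuousAt_const (ContinuousAt.log ?_ this))
    (by fun_prop) h2
  refine continuousAt_const.add (ContinuousAt.div (by fun_prop) (by fun_prop) hd.ne')

lemma ofReal_inv_le_greenKernel {x y : ℝ × ℝ} (hx : x ∈ H) (hy : y ∈ H) (hne : y ≠ x) :
    ENNReal.ofReal (1 / (π * ((x.1 - y.1) ^ 2 + (x.2 + y.2) ^ 2))) ≤ greenKernel x y := by
  have hx2 : 0 < x.2 := hx
  have hy2 : 0 < y.2 := hy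
  have hd := distSq_pos hne
  apply ENNReal.ofReal_le_ofReal
  unfold G
  have hS : (x.1 - y.1) ^ 2 + (x.2 + y.2) ^ 2 =
      (x.1 - y.1) ^ 2 + (x.2 - y.2) ^ 2 + 4 * x.2 * y.2 := by ring
  rw [hS]
  set D := (x.1 - y.1) ^ 2 + (x.2 - y.2) ^ 2
  have h1 := Real.one_sub_inv_le_log_of_pos (x := 1 + 4 * x.2 * y.2 / D) (by positivity)
  calc 1 / (π * (D + 4 * x.2 * y.2)) =
        1 / (4 * π) * (1 - (1 + 4 * x.2 * y.2 / D)⁻¹) / (x.2 * y.2) := by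
        field_simp
        ring
    _ ≤ _ := by gcongr

lemma originPot_eq {Ω : Set (ℝ × ℝ)} (hΩ : MeasurableSet Ω) (hΩH : Ω ⊆ H) :
    originPot Ω = ∫⁻ y, ENNReal.ofReal (1 / (π * (y.1 ^ 2 + y.2 ^ 2))) * Ω.indicator 1 y
      ∂impulseMeasure := by
  unfold originPot
  rw [lintegral_impulseMeasure, ← lintegral_indicator hΩ]
  congr 1 with y
  by_cases hy : y ∈ Ω
  · have hy2 : 0 < y.2 := hΩH hy
    rw [indicator_of_mem hy, indicator_of_mem hy, Pi.one_apply, mul_one,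
      ← ENNReal.ofReal_mul hy2.le]
    unfold halfPlanePoisson
    rw [mul_one_div]
  · simp [indicator_of_notMem hy]

lemma exists_halfDisc_subset {Ω : Set (ℝ × ℝ)} (hΩ : MeasurableSet Ω) (hΩH : Ω ⊆ H) {c : ℝ≥0∞}
    (hc : c < originPot Ω) :
    ∃ R : ℝ, 0 < R ∧
      {x ∈ H | x.1 ^ 2 + x.2 ^ 2 < R ^ 2} ⊆ {x ∈ H | c < relPot (Ω.indicator 1) x} := by
  rw [originPot_eq hΩ hΩH] at hc
  have hm : Measurable (Ω.indicator (1 : ℝ × ℝ → ℝ≥0∞)) := measurable_one.indicator hΩ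
  have hev := eventually_lt_lintegral_mul (l := 𝓝 0)
    (k := fun x y => ENNReal.ofReal (1 / (π * ((x.1 - y.1) ^ 2 + (x.2 + y.2) ^ 2))))
    (fun x => by fun_prop) hm (fun y => indicator_le_self' (by simp) y) ?_ hc
  · obtain ⟨R, hR, hball⟩ := Metric.eventually_nhds_iff.1 hev
    refine ⟨R, hR, fun x hx => ⟨hx.1, (hball (y := x) ?_).trans_le ?_⟩⟩
    · have h1 := hx.2
      rw [dist_zero_right, Prod.norm_def, max_lt_iff, Real.norm_eq_abs, Real.norm_eq_abs]
      constructor <;> refine abs_lt_of_sq_lt_sq ?_ hR.le <;>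
        nlinarith [sq_nonneg x.1, sq_nonneg x.2]
    · unfold relPot
      apply lintegral_mono_ae
      filter_upwards [ae_mem_H, ae_impulseMeasure_ne x] with y hy hne
      gcongr
      exact ofReal_inv_le_greenKernel hx.1 hy hne
  · filter_upwards [ae_mem_H] with y hy
    have hy2 : 0 < y.2 := hy
    have hcont : ContinuousAt (fun x : ℝ × ℝ =>
        ENNReal.ofReal (1 / (π * ((x.1 - y.1) ^ 2 + (x.2 + y.2) ^ 2)))) 0 := by
      refine ENNReal.continuous_ofReal.continuousAt.comp ?_
      refine ContinuousAt.div continuousAt_const (by fun_prop) ?_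
      simp only [Prod.fst_zero, Prod.snd_zero]
      positivity
    simpa using hcont.tendsto

/-! ### Passage to real integrals -/

lemma Gpot_indicator {Ω : Set (ℝ × ℝ)} (hΩ : MeasurableSet Ω) (hΩH : Ω ⊆ H) {x : ℝ × ℝ}
    (hx : x ∈ H) :
    Gpot (Ω.indicator fun _ => (1 : ℝ)) x = x.2 * (relPot (Ω.indicator 1) x).toReal := by
  have hx2 : 0 < x.2 := hx
  have hGm : Measurable fun y => G x y := measurable_G.comp (by fun_prop : Measurable fun y => (x, y))
  have hm1 : Measurable (Ω.indicator fun _ => (1 : ℝ)) := measurable_const.indicator hΩ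
  have hm : Measurable (Ω.indicator (1 : ℝ × ℝ → ℝ≥0∞)) := measurable_one.indicator hΩ
  unfold Gpot
  rw [integral_eq_lintegral_of_nonneg_ae ?_ (by fun_prop), ← ENNReal.toReal_ofReal hx2.le,
    ← ENNReal.toReal_mul]
  · congr 1
    unfold relPot
    rw [lintegral_impulseMeasure, ← lintegral_const_mul _ (by fun_prop),
      ← lintegral_indicator measurableSet_H]
    congr 1 with y
    by_cases hy : y ∈ Ω
    · rw [indicator_of_mem (hΩH hy), indicator_of_mem hy, indicator_of_mem hy, Pi.one_apply,
        mul_one, mul_one, ofReal_mul_greenKernel_mul hx (hΩH hy)]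
    · by_cases hyH : y ∈ H
      · simp [indicator_of_notMem hy, indicator_of_mem hyH]
      · simp [indicator_of_notMem hy, indicator_of_notMem hyH]
  · filter_upwards [ae_restrict_mem measurableSet_H] with y hy
    exact mul_nonneg (G_nonneg hx hy) (indicator_nonneg (fun _ _ => zero_le_one) _)

lemma energy_indicator {Ω : Set (ℝ × ℝ)} (hΩ : MeasurableSet Ω) (hΩH : Ω ⊆ H)
    (hP : impulseMeasure Ω ≤ 1) :
    energy (Ω.indicator fun _ => (1 : ℝ)) = 1 / 2 * (dblEnergy (Ω.indicator 1)).toReal := by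
  have hm : Measurable (Ω.indicator (1 : ℝ × ℝ → ℝ≥0∞)) := measurable_one.indicator hΩ
  have hm1 : Measurable (Ω.indicator fun _ => (1 : ℝ)) := measurable_const.indicator hΩ
  have hp := relPot_measurable hm
  have h9 : ∀ x ∈ H, relPot (Ω.indicator 1) x ≠ ⊤ := fun x hx =>
    ((relPot_le_nine hm (fun y => indicator_le_self' (by simp) y) hx
      (by rwa [lintegral_indicator_one hΩ])).trans_lt (by simp)).ne
  have h1 : ∫ x in H, ∫ y in H, G x y * (Ω.indicator fun _ => (1 : ℝ)) x *
      (Ω.indicator fun _ => (1 : ℝ)) y =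
      ∫ x in H, x.2 * (relPot (Ω.indicator 1) x).toReal * (Ω.indicator fun _ => (1 : ℝ)) x := by
    apply setIntegral_congr_fun measurableSet_H
    intro x hx
    simp only
    rw [← Gpot_indicator hΩ hΩH hx]
    unfold Gpot
    rw [← integral_mul_const]
    congr 1 with y
    ring
  unfold energy
  rw [h1, integral_eq_lintegral_of_nonneg_ae ?_ (by fun_prop)]
  · congr 2
    unfold dblEnergy
    rw [lintegral_impulseMeasure, ← lintegral_indicator measurableSet_H]
    congr 1 with x
    by_cases hx : x ∈ Ω
    · have hx2 : 0 < x.2 := hΩH hx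
      rw [indicator_of_mem (hΩH hx), indicator_of_mem hx, indicator_of_mem hx, Pi.one_apply,
        mul_one, mul_one, ENNReal.ofReal_mul hx2.le, ENNReal.ofReal_toReal (h9 x (hΩH hx))]
    · by_cases hxH : x ∈ H
      · simp [indicator_of_notMem hx, indicator_of_mem hxH]
      · simp [indicator_of_notMem hx, indicator_of_notMem hxH]
  · filter_upwards [ae_restrict_mem measurableSet_H] with x hx
    have hx2 : 0 < x.2 := hx
    exact mul_nonneg (by positivity) (indicator_nonneg (fun _ _ => zero_le_one) _)

lemma setIntegral_snd_eq {Ω : Set (ℝ × ℝ)} (hΩ : MeasurableSet Ω) (hΩH : Ω ⊆ H) :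
    ∫ x in Ω, x.2 = (impulseMeasure Ω).toReal := by
  rw [integral_eq_lintegral_of_nonneg_ae ?_ (by fun_prop), ← setLIntegral_one,
    setLIntegral_impulseMeasure hΩ (fun _ => 1)]
  · simp
  · filter_upwards [ae_restrict_mem hΩ] with x hx
    exact (hΩH hx : 0 < x.2).le

lemma IsSteiner.steinerSet {Ω : Set (ℝ × ℝ)} (h : IsSteiner (Ω.indicator 1)) : SteinerSet Ω := by
  have key : ∀ a b t : ℝ, |a| ≤ |b| → (b, t) ∈ Ω → (a, t) ∈ Ω := by
    intro a b t hab hb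
    by_contra hc
    have := h.anti a b t hab
    rw [indicator_of_mem hb, indicator_of_notMem hc] at this
    simp at this
  refine ⟨fun a t _ => ⟨key _ _ _ (by simp), key _ _ _ (by simp)⟩, fun t _ a b ha hab => ?_⟩
  exact key a b t (by rwa [abs_of_nonneg ha, abs_of_nonneg (ha.trans hab)])

/-- Existence of a Sadovskii vortex patch (steady form): a bounded open
Steiner-symmetric set `Ω ⊆ ℝ²₊` of unit impulse, with `W = (4/3)E(1_Ω) > 0`, such that
`Ω = {x ∈ ℝ²₊ : 𝒢[1_Ω](x) − W x₂ > 0}` and `Ω` contains a half-disc around the origin. -/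
theorem sadovskii_vortex_patch_exists :
    ∃ Ω : Set (ℝ × ℝ), IsOpen Ω ∧ Bornology.IsBounded Ω ∧ Ω ⊆ H ∧
      SteinerSet Ω ∧ (∫ x in Ω, x.2) = 1 ∧
      ∃ W : ℝ, 0 < W ∧ W = (4 / 3) * energy (Ω.indicator fun _ => (1 : ℝ)) ∧
        Ω = {x ∈ H | 0 < Gpot (Ω.indicator fun _ => (1 : ℝ)) x - W * x.2} ∧
        ∃ R : ℝ, 0 < R ∧ {x ∈ H | x.1 ^ 2 + x.2 ^ 2 < R ^ 2} ⊆ Ω := by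
  obtain ⟨Ω, hΩ, hS, hP, hE, heq, A, hA⟩ := exists_maximizing_patch
  have hΩH : Ω ⊆ H := hA.trans (box_subset_H A)
  have hm : Measurable (Ω.indicator (1 : ℝ × ℝ → ℝ≥0∞)) := measurable_one.indicator hΩ
  have hm1 : ∀ y, Ω.indicator (1 : ℝ × ℝ → ℝ≥0∞) y ≤ 1 := fun y => indicator_le_self' (by simp) y
  obtain ⟨R, hR, hdisc⟩ :=
    exists_halfDisc_subset hΩ hΩH (patchSpeed_lt_originPot hΩ hS hP hE hA)
  refine ⟨Ω, ?_, ?_, hΩH, hS.steinerSet, ?_, patchSpeed, patchSpeed_pos, ?_, ?_, R, hR, ?_⟩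
  · rw [heq]
    exact isOpen_superlevel hm hm1 _
  · exact ((Metric.isBounded_Ioo _ _).prod (Metric.isBounded_Ioo _ _)).subset hA
  · rw [setIntegral_snd_eq hΩ hΩH, hP, ENNReal.toReal_one]
  · rw [energy_indicator hΩ hΩH hP.le, hE]
    unfold patchSpeed
    ring
  · refine heq.trans (Set.ext fun x => and_congr_right fun hx => ?_)
    have hx2 : 0 < x.2 := hx
    have h9 : relPot (Ω.indicator 1) x ≠ ⊤ :=
      ((relPot_le_nine hm hm1 hx (by rw [lintegral_indicator_one hΩ, hP])).trans_lt (by simp)).ne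
    rw [Gpot_indicator hΩ hΩH hx, ENNReal.ofReal_lt_iff_lt_toReal patchSpeed_pos.le h9,
      mul_comm patchSpeed, ← mul_sub, mul_pos_iff_of_pos_left hx2, sub_pos]
  · rw [heq]
    exact hdisc
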